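/- arXiv:1908.09408 — 2 statements merged into one kernel-verified Lean document; each statement's English description precedes it below -/
import Mathlib

section
/- Let n ≥ 1 and let p ∈ L¹(ℝ^n) be symmetric under permutations of its arguments. Set s^{(n)} = (n−1, n−2, …, 1, 0). For s' ∈ ℝ^n and L ∈ {0,1}^n define Sp(s', L) = (∏_{j=0}^{n−1} j!) ∫_{ℝ^n} p(a) · det[ sign(a_c)^{L_b} |a_c|^{i s'_b + n − b} ]_{b,c=1,…,n} / ( Δ_n(a) · Δ_n(i s' + s^{(n)}) ) da (the a-integrand is bounded by a constant times |p(a)|, so Sp is well defined; Δ_n(i s' + s^{(n)}) never vanishes). Then for every ε > 0 the following s'-integrals converge, and for almost every a ∈ ℝ^n: p(a) = ( Δ_n(a) / ( (n!)² ∏_{j=0}^{n−1} j! ) ) · lim_{ε→0+} ∑_{L ∈ {0,1}^n} (4π)^{−n} ∫_{ℝ^n} Sp(s', L) · ( ∏_{l=1}^{n} ζ_n(ε s'_l) ) · Δ_n(i s' + s^{(n)}) · det[ sign(a_c)^{L_b} |a_c|^{−i s'_b − n + b − 1} ]_{b,c=1,…,n} ds'. -/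
open MeasureTheory Finset Filter Set
open scoped Classical

noncomputable section

namespace RMT

/-- The function `cos(z) / ∏_{k=1}^n (1 - 4z²/(π(2k-1))²)`, as a raw formula. -/
def zetaRaw (n : ℕ) (z : ℝ) : ℝ :=
  Real.cos z / ∏ k ∈ Finset.range n, (1 - 4 * z ^ 2 / (Real.pi * (2 * (k : ℝ) + 1)) ^ 2)

/-- The regularizing function `ζ_n`, with the removable singularities at
`z = ±π(2k-1)/2` filled by continuity. -/
def zetaReg (n : ℕ) (z : ℝ) : ℝ :=
  if (∏ k ∈ Finset.range n, (1 - 4 * z ^ 2 / (Real.pi * (2 * (k : ℝ) + 1)) ^ 2)) ≠ 0 then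
    zetaRaw n z
  else limUnder (nhdsWithin z {z}ᶜ) (zetaRaw n)

end RMT

namespace RMT

/-- The Vandermonde determinant `Δ_n(a) = ∏_{c>d}(a_c - a_d)` (real entries). -/
def VdmF {n : ℕ} (a : Fin n → ℝ) : ℝ := ∏ c : Fin n, ∏ d ∈ Finset.Iio c, (a c - a d)

/-- The Vandermonde determinant `Δ_n(s) = ∏_{c>d}(s_c - s_d)` (complex entries). -/
def VdmCF {n : ℕ} (s : Fin n → ℂ) : ℂ := ∏ c : Fin n, ∏ d ∈ Finset.Iio c, (s c - s d)

/-- The shifted frequency vector `i s' + s^{(n)}`, where `s^{(n)} = (n-1, …, 1, 0)`. -/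
def sShift (n : ℕ) (s' : Fin n → ℝ) : Fin n → ℂ :=
  fun b => Complex.I * (s' b : ℝ) + ((n - 1 - (b : ℕ) : ℕ) : ℂ)

/-- The spherical transform `Sp(s', L)` of a symmetric integrable function `p` on `ℝ^n`. -/
def spTrans (n : ℕ) (p : (Fin n → ℝ) → ℝ) (s' : Fin n → ℝ) (L : Fin n → Fin 2) : ℂ :=
  (∏ j ∈ Finset.range n, (Nat.factorial j : ℂ)) *
    ∫ a : Fin n → ℝ,
      (p a : ℂ) *
        (if (∃ c, a c = 0) ∨ ∃ c d, c ≠ d ∧ a c = a d then 0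
         else
           Matrix.det (Matrix.of fun b c : Fin n =>
             ((Real.sign (a c) : ℝ) : ℂ) ^ (L b : ℕ) *
               ((|a c| : ℝ) : ℂ) ^ (Complex.I * (s' b : ℝ) + ((n - 1 - (b : ℕ) : ℕ) : ℂ))) /
             (VdmCF (fun c => ((a c : ℝ) : ℂ)) * VdmCF (sShift n s')))

/-- The `s'`-integrand of the inversion formula, for fixed `a`, `L` and regularization `ε`. -/
def invIntegrand (n : ℕ) (p : (Fin n → ℝ) → ℝ) (a : Fin n → ℝ) (L : Fin n → Fin 2) (ε : ℝ)
    (s' : Fin n → ℝ) : ℂ :=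
  spTrans n p s' L * (∏ l : Fin n, ((zetaReg n (ε * s' l) : ℝ) : ℂ)) * VdmCF (sShift n s') *
    Matrix.det (Matrix.of fun b c : Fin n =>
      ((Real.sign (a c) : ℝ) : ℂ) ^ (L b : ℕ) *
        ((|a c| : ℝ) : ℂ) ^ (-(Complex.I * (s' b : ℝ)) + (((b : ℕ) : ℤ) - (n : ℤ) : ℤ)))


/-- Divided difference of a complex-valued function over a finite set of real nodes. -/
def ddc (g : ℝ → ℂ) (A : Finset ℝ) : ℂ :=
  ∑ x ∈ A, g x / ((∏ y ∈ A.erase x, (x - y) : ℝ) : ℂ)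

theorem rolle_iter (I : Set ℝ) (hI : I.OrdConnected) (k : ℕ) :
    ∀ (F : ℕ → ℝ → ℝ), (∀ j, ∀ x ∈ I, HasDerivAt (F j) (F (j+1) x) x) →
    ∀ x : ℕ → ℝ, (∀ i < k, x i < x (i+1)) → (∀ i ≤ k, x i ∈ I) → (∀ i ≤ k, F 0 (x i) = 0) →
    ∃ ξ ∈ I, F k ξ = 0 := by
  induction k with
  | zero =>
    intro F _ x _ hxI h0
    exact ⟨x 0, hxI 0 le_rfl, h0 0 le_rfl⟩
  | succ k ih =>
    intro F hF x hx hxI h0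
    have key : ∀ i : ℕ, ∃ y, i ≤ k → (x i < y ∧ y < x (i+1) ∧ F 1 y = 0) := by
      intro i
      by_cases hi : i ≤ k
      · have hsub : Set.Icc (x i) (x (i+1)) ⊆ I := hI.out (hxI i (by omega)) (hxI (i+1) (by omega))
        obtain ⟨c, hc, hc0⟩ := exists_hasDerivAt_eq_zero (f := F 0) (f' := F 1) (hx i (by omega))
          (fun z hz => (hF 0 z (hsub hz)).continuousAt.continuousWithinAt)
          (by rw [h0 i (by omega), h0 (i+1) (by omega)])
          (fun z hz => hF 0 z (hsub (Set.Ioo_subset_Icc_self hz)))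
        exact ⟨c, fun _ => ⟨hc.1, hc.2, hc0⟩⟩
      · exact ⟨0, fun h => absurd h hi⟩
    choose y hy using key
    obtain ⟨ξ, hξ, h⟩ := ih (fun j => F (j+1)) (fun j z hz => hF (j+1) z hz) y
      (fun i hi => (hy i (by omega)).2.1.trans (hy (i+1) (by omega)).1)
      (fun i hi => hI.out (hxI i (by omega)) (hxI (i+1) (by omega))
        ⟨(hy i hi).1.le, (hy i hi).2.1.le⟩)
      (fun i hi => (hy i hi).2.2)
    exact ⟨ξ, hξ, h⟩

theorem dd_mvt (I : Set ℝ) (hI : I.OrdConnected) (k : ℕ) (F : ℕ → ℝ → ℝ)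
    (hF : ∀ j, ∀ x ∈ I, HasDerivAt (F j) (F (j+1) x) x)
    (A : Finset ℝ) (hA : ∀ x ∈ A, x ∈ I) (hk : A.card = k + 1) :
    ∃ ξ ∈ I, F k ξ = k.factorial * ∑ x ∈ A, F 0 x / ∏ y ∈ A.erase x, (x - y) := by
  set P := Lagrange.interpolate A (id : ℝ → ℝ) (F 0) with hP
  have hinj : Set.InjOn (id : ℝ → ℝ) A := Set.injOn_id _
  obtain ⟨ξ, hξ, h⟩ := rolle_iter I hI k
    (fun j x => F j x - (Polynomial.derivative^[j] P).eval x)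
    (by
      intro j x hx
      refine (hF j x hx).sub ?_
      rw [Function.iterate_succ_apply']
      exact Polynomial.hasDerivAt _ _)
    (fun i => if h : i < k + 1 then A.orderEmbOfFin hk ⟨i, h⟩ else 0)
    (by
      intro i hi
      have h1 : i < k + 1 := by omega
      have h2 : i + 1 < k + 1 := by omega
      simp only [h1, h2, dif_pos]
      exact (A.orderEmbOfFin hk).strictMono (by simp [Fin.lt_def]))
    (by
      intro i hi
      have h1 : i < k + 1 := by omega
      simp only [h1, dif_pos]
      exact hA _ (Finset.orderEmbOfFin_mem _ _ _))
    (by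
      intro i hi
      have h1 : i < k + 1 := by omega
      simp only [h1, dif_pos, Function.iterate_zero, id]
      have := Lagrange.eval_interpolate_at_node (F 0) hinj (A.orderEmbOfFin_mem hk ⟨i, h1⟩)
      simp only [id] at this
      rw [hP]
      change _ - Polynomial.eval _ _ = 0
      rw [this, sub_self])
  refine ⟨ξ, hξ, ?_⟩
  have h' : F k ξ = (Polynomial.derivative^[k] P).eval ξ := by linarith
  rw [h', hP, Lagrange.iterate_derivative_interpolate _ hinj (by omega)]
  simp [hk, Polynomial.eval_finsetSum]

theorem ddc_mvt_bound (I : Set ℝ) (hI : I.OrdConnected) (k : ℕ) (F : ℕ → ℝ → ℂ)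
    (hF : ∀ j, ∀ x ∈ I, HasDerivAt (F j) (F (j+1) x) x)
    (A : Finset ℝ) (hA : ∀ x ∈ A, x ∈ I) (hk : A.card = k + 1) (M : ℝ)
    (hM : ∀ x ∈ I, ‖F k x‖ ≤ M) : ‖ddc (F 0) A‖ ≤ 2 * M := by
  have hre : (ddc (F 0) A).re = ∑ x ∈ A, (F 0 x).re / ∏ y ∈ A.erase x, (x - y) := by
    simp only [ddc, Complex.re_sum, Complex.div_ofReal_re]
  have him : (ddc (F 0) A).im = ∑ x ∈ A, (F 0 x).im / ∏ y ∈ A.erase x, (x - y) := by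
    simp only [ddc, Complex.im_sum, Complex.div_ofReal_im]
  obtain ⟨ξ, hξ, h1⟩ := dd_mvt I hI k (fun j x => (F j x).re)
    (fun j x hx => by
      exact (Complex.reCLM.hasFDerivAt.comp_hasDerivAt x (hF j x hx))) A hA hk
  obtain ⟨η, hη, h2⟩ := dd_mvt I hI k (fun j x => (F j x).im)
    (fun j x hx => by
      exact (Complex.imCLM.hasFDerivAt.comp_hasDerivAt x (hF j x hx))) A hA hk
  rw [← hre] at h1
  rw [← him] at h2
  have hf : (1:ℝ) ≤ k.factorial := by exact_mod_cast Nat.succ_le_of_lt k.factorial_pos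
  have b1 : |(ddc (F 0) A).re| ≤ M := by
    calc _ ≤ (k.factorial : ℝ) * |(ddc (F 0) A).re| := le_mul_of_one_le_left (abs_nonneg _) hf
      _ = |(F k ξ).re| := by rw [h1, abs_mul, abs_of_nonneg (by positivity : (0:ℝ) ≤ k.factorial)]
      _ ≤ _ := (Complex.abs_re_le_norm _).trans (hM _ hξ)
  have b2 : |(ddc (F 0) A).im| ≤ M := by
    calc _ ≤ (k.factorial : ℝ) * |(ddc (F 0) A).im| := le_mul_of_one_le_left (abs_nonneg _) hf
      _ = |(F k η).im| := by rw [h2, abs_mul, abs_of_nonneg (by positivity : (0:ℝ) ≤ k.factorial)]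
      _ ≤ _ := (Complex.abs_im_le_norm _).trans (hM _ hη)
  have := Complex.norm_le_abs_re_add_abs_im (ddc (F 0) A)
  linarith

theorem ddc_rec (g : ℝ → ℂ) (A : Finset ℝ) (i j : ℝ) (hi : i ∈ A) (hj : j ∈ A) :
    ((j - i : ℝ) : ℂ) * ddc g A = ddc g (A.erase i) - ddc g (A.erase j) := by
  have hne : ∀ (B : Finset ℝ) (x : ℝ), ((∏ y ∈ B.erase x, (x - y) : ℝ) : ℂ) ≠ 0 := by
    intro B x
    rw [Complex.ofReal_ne_zero, Finset.prod_ne_zero_iff]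
    intro y hy
    exact sub_ne_zero.2 (Finset.ne_of_mem_erase hy).symm
  have hstep : ∀ e ∈ A, ddc g (A.erase e) =
      ∑ x ∈ A, g x * ((x - e : ℝ) : ℂ) / ((∏ y ∈ A.erase x, (x - y) : ℝ) : ℂ) := by
    intro e he
    rw [← Finset.add_sum_erase A _ he]
    simp only [sub_self, Complex.ofReal_zero, mul_zero, zero_div, zero_add]
    unfold ddc
    refine Finset.sum_congr rfl fun x hx => ?_
    have hxe : x ≠ e := Finset.ne_of_mem_erase hx
    have : (∏ y ∈ A.erase x, (x - y)) = (x - e) * ∏ y ∈ (A.erase e).erase x, (x - y) := by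
      rw [Finset.erase_right_comm, Finset.mul_prod_erase (A.erase x) (fun y => x - y)
        (Finset.mem_erase.2 ⟨hxe.symm, he⟩)]
    rw [this, Complex.ofReal_mul]
    have h1 : ((x - e : ℝ) : ℂ) ≠ 0 := by
      rw [Complex.ofReal_ne_zero]; exact sub_ne_zero.2 hxe
    have h2 := hne (A.erase e) x
    field_simp
  rw [hstep i hi, hstep j hj, ← Finset.sum_sub_distrib, ddc, Finset.mul_sum]
  refine Finset.sum_congr rfl fun x hx => ?_
  rw [← sub_div, mul_div_assoc']
  congr 1
  push_cast
  ring

theorem ddc_bound (m : ℕ) (N k : ℕ) (hk : k ≤ N) : ∃ C : ℝ, 0 ≤ C ∧ ∀ (F : ℕ → ℝ → ℂ) (M : ℝ), 0 ≤ M →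
    (∀ j, ∀ x ≠ 0, HasDerivAt (F j) (F (j+1) x) x) →
    (∀ j < N, ∀ x ≠ 0, ‖F j x‖ ≤ M * |x| ^ ((m:ℤ) - j)) →
    ∀ A : Finset ℝ, A.card = k → (0:ℝ) ∉ A → ∀ R : ℝ, (∀ x ∈ A, |x| ≤ R) →
    ∀ B ⊆ A, ∀ t : ℕ, B.card + m + 1 = k + t →
    ‖ddc (F 0) A‖ * ∏ x ∈ B, |x| ≤ C * M * R ^ t := by
  induction k with
  | zero =>
    refine ⟨0, le_rfl, ?_⟩
    intro F M hM _ _ A hA _ R _ B _ t _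
    rw [Finset.card_eq_zero] at hA
    subst hA
    simp [ddc]
  | succ k ih =>
    obtain ⟨C, hC, ih⟩ := ih (by omega)
    refine ⟨max (4 * C) (2 * 2 ^ (m + k)), by positivity, ?_⟩
    intro F M hM hF hb A hA h0 R hR B hB t ht
    have hAne : A.Nonempty := by rw [← Finset.card_pos]; omega
    obtain ⟨x₀, hx₀, hmax⟩ := A.exists_max_image (fun x => |x|) hAne
    set R₀ := |x₀| with hR₀
    have hx₀0 : x₀ ≠ 0 := fun h => h0 (h ▸ hx₀)
    have hR₀pos : 0 < R₀ := abs_pos.2 hx₀0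
    have hR₀R : R₀ ≤ R := hR x₀ hx₀
    suffices hs : ‖ddc (F 0) A‖ * ∏ x ∈ B, |x| ≤ max (4 * C) (2 * 2 ^ (m + k)) * M * R₀ ^ t from
      hs.trans (by gcongr)
    by_cases hcase : ∃ y ∈ A, R₀ / 2 ≤ |x₀ - y|
    · obtain ⟨y, hy, hxy⟩ := hcase
      have hne : y ≠ x₀ := by
        rintro rfl
        simp at hxy; linarith
      have hrec := ddc_rec (F 0) A y x₀ hy hx₀
      have hbd : ∀ e ∈ A, ‖ddc (F 0) (A.erase e)‖ * ∏ x ∈ B, |x| ≤ R₀ * (C * M * R₀ ^ t) := by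
        intro e he
        have hcard : (A.erase e).card = k := by rw [Finset.card_erase_of_mem he, hA]; rfl
        have h0' : (0:ℝ) ∉ A.erase e := fun h => h0 (Finset.mem_of_mem_erase h)
        have hR' : ∀ x ∈ A.erase e, |x| ≤ R₀ := fun x hx => hmax x (Finset.mem_of_mem_erase hx)
        rcases B.eq_empty_or_nonempty with hBe | hBne
        · subst hBe
          have := ih F M hM hF hb (A.erase e) hcard h0' R₀ hR' ∅ (by simp) (t+1) (by simp at ht ⊢; omega)
          calc _ ≤ _ := this
            _ = _ := by rw [pow_succ]; ring
        · obtain ⟨z, hz, hzsub⟩ : ∃ z ∈ B, B.erase z ⊆ A.erase e := by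
            by_cases heB : e ∈ B
            · exact ⟨e, heB, Finset.erase_subset_erase _ hB⟩
            · obtain ⟨z, hz⟩ := hBne
              refine ⟨z, hz, fun w hw => ?_⟩
              have hwB := Finset.mem_of_mem_erase hw
              exact Finset.mem_erase.2 ⟨fun h => heB (h ▸ hwB), hB hwB⟩
          have hBc : 0 < B.card := Finset.card_pos.2 ⟨z, hz⟩
          have := ih F M hM hF hb (A.erase e) hcard h0' R₀ hR' (B.erase z) hzsub t
            (by rw [Finset.card_erase_of_mem hz]; omega)
          rw [← Finset.mul_prod_erase B _ hz]
          calc _ = |z| * (‖ddc (F 0) (A.erase e)‖ * ∏ x ∈ B.erase z, |x|) := by ring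
            _ ≤ R₀ * (C * M * R₀ ^ t) := by
              gcongr
              exact hmax z (hB hz)
      have hnorm : ‖((x₀ - y : ℝ) : ℂ) * ddc (F 0) A‖ * ∏ x ∈ B, |x| ≤ 2 * (R₀ * (C * M * R₀ ^ t)) := by
        rw [hrec]
        calc _ ≤ (‖ddc (F 0) (A.erase y)‖ + ‖ddc (F 0) (A.erase x₀)‖) * ∏ x ∈ B, |x| := by
              gcongr
              exact norm_sub_le _ _
          _ ≤ _ := by rw [add_mul]; linarith [hbd y hy, hbd x₀ hx₀]
      rw [norm_mul, Complex.norm_real, Real.norm_eq_abs] at hnorm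
      have hnn : 0 ≤ ‖ddc (F 0) A‖ * ∏ x ∈ B, |x| := by positivity
      have : R₀ / 2 * (‖ddc (F 0) A‖ * ∏ x ∈ B, |x|) ≤ R₀ / 2 * (4 * C * M * R₀ ^ t) := by
        calc _ ≤ |x₀ - y| * (‖ddc (F 0) A‖ * ∏ x ∈ B, |x|) := by gcongr
          _ ≤ 2 * (R₀ * (C * M * R₀ ^ t)) := by rw [← mul_assoc]; exact hnorm
          _ = _ := by ring
      have := le_of_mul_le_mul_left this (by positivity)
      refine this.trans ?_
      gcongr
      exact le_max_left _ _
    · push Not at hcase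
      have hI : ∀ x ∈ Set.Ioo (x₀ - R₀/2) (x₀ + R₀/2), R₀ / 2 ≤ |x| ∧ |x| ≤ 2 * R₀ := by
        intro x hx
        have h1 : |x₀ - x| < R₀ / 2 := by rw [abs_lt]; constructor <;> linarith [hx.1, hx.2]
        have h2 := abs_sub_abs_le_abs_sub x₀ x
        have h3 := abs_sub_abs_le_abs_sub x x₀
        rw [abs_sub_comm] at h3
        constructor <;> linarith
      have hdd := ddc_mvt_bound (Set.Ioo (x₀ - R₀/2) (x₀ + R₀/2)) Set.ordConnected_Ioo k F
        (fun j x hx => hF j x (abs_pos.1 (lt_of_lt_of_le (by positivity) (hI x hx).1))) A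
        (fun x hx => by
          have := abs_lt.1 (hcase x hx)
          constructor <;> linarith) hA (M * (2 ^ (m + k) * R₀ ^ ((m:ℤ) - k)))
        (by
          intro x hx
          have hxp : 0 < |x| := lt_of_lt_of_le (by positivity) (hI x hx).1
          refine (hb k (by omega) x (abs_pos.1 hxp)).trans ?_
          gcongr
          rcases le_total k m with hkm | hkm
          · obtain ⟨d, rfl⟩ := Nat.exists_eq_add_of_le hkm
            have : ((k + d : ℕ) : ℤ) - k = (d : ℤ) := by push_cast; ring
            rw [this, zpow_natCast, zpow_natCast]
            calc |x| ^ d ≤ (2 * R₀) ^ d := by gcongr; exact (hI x hx).2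
              _ = 2 ^ d * R₀ ^ d := mul_pow _ _ _
              _ ≤ _ := by
                gcongr
                · norm_num
                · omega
          · obtain ⟨d, rfl⟩ := Nat.exists_eq_add_of_le hkm
            have : (m : ℤ) - ((m + d : ℕ) : ℤ) = -(d : ℤ) := by push_cast; ring
            rw [this, zpow_neg, zpow_neg, zpow_natCast, zpow_natCast]
            calc (|x| ^ d)⁻¹ ≤ ((R₀ / 2) ^ d)⁻¹ := by gcongr; exact (hI x hx).1
              _ = 2 ^ d * (R₀ ^ d)⁻¹ := by rw [div_pow, inv_div, div_eq_mul_inv]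
              _ ≤ _ := by
                gcongr
                · norm_num
                · omega)
      have hprod : ∏ x ∈ B, |x| ≤ R₀ ^ B.card := by
        rw [← Finset.prod_const]
        exact Finset.prod_le_prod (fun _ _ => abs_nonneg _) (fun x hx => hmax x (hB hx))
      calc _ ≤ (2 * (M * (2 ^ (m + k) * R₀ ^ ((m:ℤ) - k)))) * R₀ ^ B.card := by gcongr
        _ = (2 * 2 ^ (m + k)) * M * (R₀ ^ ((m:ℤ) - k) * R₀ ^ (B.card : ℤ)) := by
          rw [zpow_natCast]; ring
        _ = (2 * 2 ^ (m + k)) * M * R₀ ^ t := by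
          have he : (m:ℤ) - k + (B.card : ℤ) = (t : ℤ) := by omega
          rw [← zpow_add₀ hR₀pos.ne', he, zpow_natCast]
        _ ≤ _ := by
          gcongr
          exact le_max_right _ _

/-- Matrix entry: `sign(x)^L |x|^z`. -/
def ent (z : ℂ) (L : ℕ) (x : ℝ) : ℂ := ((Real.sign x : ℝ) : ℂ) ^ L * ((|x| : ℝ) : ℂ) ^ z

/-- The derivatives of `ent`. -/
def entD (z : ℂ) (L : ℕ) (j : ℕ) (x : ℝ) : ℂ :=
  (∏ i ∈ Finset.range j, (z - (i : ℂ))) * ent (z - (j : ℂ)) (L + j) x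

theorem hasDerivAt_abs_cpow (w : ℂ) (x : ℝ) (hx : x ≠ 0) :
    HasDerivAt (fun y : ℝ => ((|y| : ℝ) : ℂ) ^ w)
      (w * ((Real.sign x : ℝ) : ℂ) * ((|x| : ℝ) : ℂ) ^ (w - 1)) x := by
  by_cases hw : w = 0
  · subst hw
    simpa using hasDerivAt_const x (1:ℂ)
  have h1 := hasDerivAt_ofReal_cpow_const (x := |x|) (abs_pos.2 hx).ne' hw
  rcases lt_or_gt_of_ne hx with h | h
  · have h2 : HasDerivAt (fun y : ℝ => |y|) (-1) x := hasDerivAt_abs_neg h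
    have := h1.scomp x h2
    refine this.congr_deriv ?_
    rw [Real.sign_of_neg h]
    simp
  · have h2 : HasDerivAt (fun y : ℝ => |y|) 1 x := hasDerivAt_abs_pos h
    have := h1.scomp x h2
    refine this.congr_deriv ?_
    rw [Real.sign_of_pos h]
    simp

theorem sign_eventually (x : ℝ) (hx : x ≠ 0) :
    (fun y : ℝ => ((Real.sign y : ℝ) : ℂ)) =ᶠ[nhds x] fun _ => ((Real.sign x : ℝ) : ℂ) := by
  rcases lt_or_gt_of_ne hx with h | h
  · filter_upwards [eventually_lt_nhds h] with y hy
    rw [Real.sign_of_neg h, Real.sign_of_neg hy]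
  · filter_upwards [eventually_gt_nhds h] with y hy
    rw [Real.sign_of_pos h, Real.sign_of_pos hy]

theorem hasDerivAt_ent (z : ℂ) (L : ℕ) (x : ℝ) (hx : x ≠ 0) :
    HasDerivAt (ent z L) (z * ent (z - 1) (L + 1) x) x := by
  have h := (hasDerivAt_abs_cpow z x hx).const_mul (((Real.sign x : ℝ) : ℂ) ^ L)
  have h2 : HasDerivAt (ent z L) (((Real.sign x : ℝ) : ℂ) ^ L * (z * ((Real.sign x : ℝ) : ℂ) * ((|x| : ℝ) : ℂ) ^ (z - 1))) x := by
    refine h.congr_of_eventuallyEq ?_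
    filter_upwards [sign_eventually x hx] with y hy
    simp only [ent]
    rw [hy]
  refine h2.congr_deriv ?_
  simp only [ent]
  ring

theorem hasDerivAt_entD (z : ℂ) (L j : ℕ) (x : ℝ) (hx : x ≠ 0) :
    HasDerivAt (entD z L j) (entD z L (j+1) x) x := by
  have h := (hasDerivAt_ent (z - (j:ℂ)) (L + j) x hx).const_mul (∏ i ∈ Finset.range j, (z - (i : ℂ)))
  refine h.congr_deriv ?_
  simp only [entD, Finset.prod_range_succ]
  rw [mul_assoc]
  congr 3
  push_cast; ring

theorem norm_sign_pow_le (x : ℝ) (L : ℕ) : ‖((Real.sign x : ℝ) : ℂ) ^ L‖ ≤ 1 := by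
  rw [norm_pow]
  refine pow_le_one₀ (norm_nonneg _) ?_
  rw [Complex.norm_real]
  rcases Real.sign_apply_eq x with h | h | h <;> rw [h] <;> simp

theorem entD_zero (z : ℂ) (L : ℕ) : entD z L 0 = ent z L := by
  funext x; simp [entD]

theorem norm_entD_le (N m L : ℕ) (hN : m < N) (s : ℝ) (j : ℕ) (hj : j < N) (x : ℝ) (hx : x ≠ 0) :
    ‖entD (Complex.I * s + (m:ℂ)) L j x‖ ≤ ((N:ℝ) * (1 + |s|)) ^ (N - 1) * |x| ^ ((m:ℤ) - j) := by
  have hxp := abs_pos.2 hx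
  have h1 : ‖∏ i ∈ Finset.range j, ((Complex.I * s + (m:ℂ)) - (i : ℂ))‖ ≤ ((N:ℝ) * (1 + |s|)) ^ (N-1) := by
    have hN1 : (1:ℝ) ≤ N := by exact_mod_cast (by omega : 1 ≤ N)
    have hb : (1:ℝ) ≤ (N:ℝ) * (1 + |s|) := by nlinarith [abs_nonneg s]
    calc _ = ∏ i ∈ Finset.range j, ‖((Complex.I * s + (m:ℂ)) - (i : ℂ))‖ := norm_prod _ _
      _ ≤ ∏ i ∈ Finset.range j, ((N:ℝ) * (1 + |s|)) := by
        refine Finset.prod_le_prod (fun _ _ => norm_nonneg _) fun i hi => ?_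
        have hi' : i < N := (Finset.mem_range.1 hi).trans hj
        have : (Complex.I * s + (m:ℂ)) - (i : ℂ) = Complex.I * s + (((m:ℝ) - i : ℝ) : ℂ) := by
          push_cast; ring
        rw [this]
        refine (norm_add_le _ _).trans ?_
        rw [norm_mul, Complex.norm_I, Complex.norm_real, Complex.norm_real, one_mul, Real.norm_eq_abs,
          Real.norm_eq_abs]
        have : |(m:ℝ) - i| ≤ N := by
          have hm' : (m:ℝ) < N := by exact_mod_cast hN
          have hiN : (i:ℝ) < N := by exact_mod_cast hi'
          have : (0:ℝ) ≤ m := by positivity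
          have : (0:ℝ) ≤ i := by positivity
          rw [abs_le]; constructor <;> linarith
        nlinarith [abs_nonneg s]
      _ = ((N:ℝ) * (1 + |s|)) ^ j := by simp
      _ ≤ _ := pow_le_pow_right₀ hb (by omega)
  have h2 : ‖ent ((Complex.I * s + (m:ℂ)) - (j:ℂ)) (L + j) x‖ ≤ |x| ^ ((m:ℤ) - j) := by
    rw [ent, norm_mul, Complex.norm_cpow_eq_rpow_re_of_pos hxp]
    have : ((Complex.I * s + (m:ℂ)) - (j:ℂ)).re = (((m:ℤ) - j : ℤ) : ℝ) := by simp
    rw [this, Real.rpow_intCast]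
    exact mul_le_of_le_one_left (by positivity) (norm_sign_pow_le _ _)
  rw [entD, norm_mul]
  gcongr

theorem VdmCF_eq {n : ℕ} (s : Fin n → ℂ) : VdmCF s = (Matrix.vandermonde s).det := by
  rw [Matrix.det_vandermonde, VdmCF]
  refine Finset.prod_comm' ?_
  intro x y
  simp

theorem VdmCF_perm {n : ℕ} (s : Fin n → ℂ) (σ : Equiv.Perm (Fin n)) :
    VdmCF (s ∘ σ) = ((Equiv.Perm.sign σ : ℤ) : ℂ) * VdmCF s := by
  rw [VdmCF_eq, VdmCF_eq, ← Matrix.det_permute]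
  rfl

theorem VdmCF_ne_zero {n : ℕ} (s : Fin n → ℂ) (hs : Function.Injective s) : VdmCF s ≠ 0 := by
  rw [VdmCF_eq]
  exact Matrix.det_vandermonde_ne_zero_iff.2 hs

theorem det_eq_ddc {n : ℕ} (f : Fin n → ℝ → ℂ) (a : Fin n → ℝ) (ha : Function.Injective a) :
    (Matrix.of fun b c : Fin n => f b (a c)).det =
      VdmCF (fun c => ((a c : ℝ) : ℂ)) *
        (Matrix.of fun b k : Fin n => ddc (f b) ((Finset.Iic k).image a)).det := by
  set T : Matrix (Fin n) (Fin n) ℂ := Matrix.of fun c k =>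
    if c ≤ k then (((∏ j ∈ (Finset.Iic k).erase c, (a c - a j) : ℝ) : ℂ))⁻¹ else 0 with hT
  have hmul : (Matrix.of fun b k : Fin n => ddc (f b) ((Finset.Iic k).image a)) =
      (Matrix.of fun b c : Fin n => f b (a c)) * T := by
    ext b k
    rw [Matrix.mul_apply, Matrix.of_apply, ddc, Finset.sum_image ha.injOn]
    simp only [Matrix.of_apply, hT, mul_ite, mul_zero]
    rw [← Finset.sum_filter]
    refine Finset.sum_congr (by ext; simp) fun c hc => ?_
    rw [div_eq_mul_inv, ← Finset.image_erase ha, Finset.prod_image ha.injOn]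
  have hdetT : T.det = (VdmCF (fun c => ((a c : ℝ) : ℂ)))⁻¹ := by
    rw [Matrix.det_of_isUpperTriangular]
    · rw [VdmCF, ← Finset.prod_inv_distrib]
      refine Finset.prod_congr rfl fun k _ => ?_
      simp only [hT, Matrix.of_apply, le_refl, if_true]
      congr 1
      push_cast
      refine Finset.prod_congr ?_ fun _ _ => rfl
      ext j; simp [lt_iff_le_and_ne, and_comm]
    · intro i j hij
      simp only [hT, Matrix.of_apply]
      rw [if_neg]
      exact not_le.2 hij
  have hV : VdmCF (fun c => ((a c : ℝ) : ℂ)) ≠ 0 :=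
    VdmCF_ne_zero _ (Complex.ofReal_injective.comp ha)
  rw [hmul, Matrix.det_mul, hdetT]
  field_simp

theorem det_bound_sorted (n : ℕ) : ∃ C : ℝ, 0 ≤ C ∧ ∀ (s : Fin n → ℝ) (L : Fin n → ℕ) (a : Fin n → ℝ),
    Function.Injective a → (∀ c, a c ≠ 0) → Monotone (fun c => |a c|) →
    ‖(Matrix.of fun b c : Fin n => ent (Complex.I * (s b : ℝ) + ((n - 1 - (b : ℕ) : ℕ) : ℂ)) (L b) (a c)).det‖ ≤
      C * (∏ b, (1 + |s b|) ^ (n - 1)) * ‖VdmCF (fun c => ((a c : ℝ) : ℂ))‖ := by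
  have hex : ∀ (b k : Fin n), ∃ C : ℝ, 0 ≤ C ∧ ∀ (F : ℕ → ℝ → ℂ) (M : ℝ), 0 ≤ M →
    (∀ j, ∀ x ≠ 0, HasDerivAt (F j) (F (j+1) x) x) →
    (∀ j < n, ∀ x ≠ 0, ‖F j x‖ ≤ M * |x| ^ (((n - 1 - (b:ℕ) : ℕ):ℤ) - j)) →
    ∀ A : Finset ℝ, A.card = (k:ℕ) + 1 → (0:ℝ) ∉ A → ∀ R : ℝ, (∀ x ∈ A, |x| ≤ R) →
    ∀ B ⊆ A, ∀ t : ℕ, B.card + (n - 1 - (b:ℕ)) + 1 = (k:ℕ) + 1 + t →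
    ‖ddc (F 0) A‖ * ∏ x ∈ B, |x| ≤ C * M * R ^ t := fun b k =>
      ddc_bound (n - 1 - (b:ℕ)) n ((k:ℕ) + 1) k.2
  choose C hC hCb using hex
  refine ⟨∑ σ : Equiv.Perm (Fin n), ∏ k, (C (σ k) k * (n:ℝ) ^ (n-1)), 
    Finset.sum_nonneg fun σ _ => Finset.prod_nonneg fun k _ => mul_nonneg (hC _ _) (by positivity), ?_⟩
  intro s L a ha h0 hmono
  rw [det_eq_ddc _ a ha, norm_mul, mul_comm]
  gcongr
  set H : Fin n → ℝ := fun k => ∏ i ∈ Finset.Iic k, |a i| with hH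
  have hHpos : ∀ k, 0 < H k := fun k => Finset.prod_pos fun i _ => abs_pos.2 (h0 i)
  have hent : ∀ b k : Fin n,
      ‖ddc (ent (Complex.I * (s b : ℝ) + ((n - 1 - (b : ℕ) : ℕ) : ℂ)) (L b)) ((Finset.Iic k).image a)‖ ≤
        (C b k * (n:ℝ) ^ (n-1)) * (1 + |s b|) ^ (n-1) * (H (Fin.rev b) / H k) := by
    intro b k
    have hrev : ((Fin.rev b : Fin n) : ℕ) = n - 1 - (b:ℕ) := by rw [Fin.val_rev]; omega
    have hlt : n - 1 - (b:ℕ) < n := by have := b.2; omega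
    have main := hCb b k (entD (Complex.I * (s b : ℝ) + ((n - 1 - (b : ℕ) : ℕ) : ℂ)) (L b))
      (((n:ℝ) * (1 + |s b|)) ^ (n - 1)) (by positivity)
      (fun j x hx => hasDerivAt_entD _ _ j x hx)
      (fun j hj x hx => norm_entD_le n _ (L b) hlt (s b) j hj x hx)
      ((Finset.Iic k).image a)
      (by rw [Finset.card_image_of_injective _ ha, Fin.card_Iic])
      (by
        intro h
        obtain ⟨c, _, hc⟩ := Finset.mem_image.1 h
        exact h0 c hc)
      |a k|
      (by
        intro x hx
        obtain ⟨c, hc, rfl⟩ := Finset.mem_image.1 hx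
        exact hmono (Finset.mem_Iic.1 hc))
    rw [entD_zero] at main
    rw [mul_div_assoc', le_div_iff₀ (hHpos k)]
    rcases le_total (Fin.rev b) k with hbk | hbk
    · have hsub : Finset.Ioc (Fin.rev b) k ⊆ Finset.Iic k := fun x hx =>
        Finset.mem_Iic.2 (Finset.mem_Ioc.1 hx).2
      have := main ((Finset.Ioc (Fin.rev b) k).image a) (Finset.image_subset_image hsub) 0
        (by
          rw [Finset.card_image_of_injective _ ha, Fin.card_Ioc, hrev]
          have : (n - 1 - (b:ℕ)) ≤ (k:ℕ) := by rw [← hrev]; exact hbk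
          omega)
      rw [Finset.prod_image ha.injOn, pow_zero, mul_one] at this
      have hHk : H k = H (Fin.rev b) * ∏ i ∈ Finset.Ioc (Fin.rev b) k, |a i| := by
        rw [hH]
        have hdj : Disjoint (Finset.Iic (Fin.rev b)) (Finset.Ioc (Fin.rev b) k) := by
          rw [Finset.disjoint_left]
          intro x hx hx'
          exact absurd (Finset.mem_Iic.1 hx) (not_le.2 (Finset.mem_Ioc.1 hx').1)
        simp only
        rw [← Finset.prod_union hdj]
        refine Finset.prod_congr ?_ fun _ _ => rfl
        ext x
        simp only [Finset.mem_Iic, Finset.mem_union, Finset.mem_Ioc]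
        constructor
        · intro hx
          rcases le_or_gt x (Fin.rev b) with h | h
          · exact Or.inl h
          · exact Or.inr ⟨h, hx⟩
        · rintro (h | h)
          · exact h.trans hbk
          · exact h.2
      rw [hHk]
      calc _ = H (Fin.rev b) * (‖ddc (ent (Complex.I * (s b : ℝ) + ((n - 1 - (b : ℕ) : ℕ) : ℂ)) (L b)) ((Finset.Iic k).image a)‖ * ∏ i ∈ Finset.Ioc (Fin.rev b) k, |a i|) := by ring
        _ ≤ H (Fin.rev b) * (C b k * ((n:ℝ) * (1 + |s b|)) ^ (n - 1)) := by
          gcongr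
        _ = _ := by rw [mul_pow]; ring
    · have := main ∅ (by simp) ((Fin.rev b : ℕ) - (k:ℕ)) (by
          rw [hrev]
          have : (k:ℕ) ≤ (n - 1 - (b:ℕ)) := by rw [← hrev]; exact hbk
          simp; omega)
      rw [Finset.prod_empty, mul_one] at this
      have hHk : |a k| ^ ((Fin.rev b : ℕ) - (k:ℕ)) * H k ≤ H (Fin.rev b) := by
        have : H (Fin.rev b) = (∏ i ∈ Finset.Ioc k (Fin.rev b), |a i|) * H k := by
          rw [hH]
          have hdj : Disjoint (Finset.Ioc k (Fin.rev b)) (Finset.Iic k) := by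
            rw [Finset.disjoint_right]
            intro x hx hx'
            exact absurd (Finset.mem_Iic.1 hx) (not_le.2 (Finset.mem_Ioc.1 hx').1)
          simp only
          rw [← Finset.prod_union hdj]
          refine Finset.prod_congr ?_ fun _ _ => rfl
          ext x
          simp only [Finset.mem_Iic, Finset.mem_union, Finset.mem_Ioc]
          constructor
          · intro hx
            rcases le_or_gt x k with h | h
            · exact Or.inr h
            · exact Or.inl ⟨h, hx⟩
          · rintro (h | h)
            · exact h.2
            · exact h.trans hbk
        rw [this]
        have := hHpos k
        gcongr
        rw [← Fin.card_Ioc, ← Finset.prod_const]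
        refine Finset.prod_le_prod (fun _ _ => abs_nonneg _) fun i hi => hmono (Finset.mem_Ioc.1 hi).1.le
      have hHk0 := hHpos k
      calc _ ≤ (C b k * ((n:ℝ) * (1 + |s b|)) ^ (n - 1) * |a k| ^ ((Fin.rev b : ℕ) - (k:ℕ))) * H k := by gcongr
        _ = (C b k * ((n:ℝ) * (1 + |s b|)) ^ (n - 1)) * (|a k| ^ ((Fin.rev b : ℕ) - (k:ℕ)) * H k) := by ring
        _ ≤ (C b k * ((n:ℝ) * (1 + |s b|)) ^ (n - 1)) * H (Fin.rev b) := by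
          gcongr
          exact mul_nonneg (hC _ _) (by positivity)
        _ = _ := by rw [mul_pow]; ring
  rw [Matrix.det_apply, Finset.sum_mul]
  refine (norm_sum_le _ _).trans (Finset.sum_le_sum fun σ _ => ?_)
  have hsg : ∀ w : ℂ, ‖Equiv.Perm.sign σ • w‖ = ‖w‖ := by
    intro w
    rcases Int.units_eq_one_or (Equiv.Perm.sign σ) with h | h <;> rw [h] <;> simp
  rw [hsg, norm_prod]
  calc _ ≤ ∏ k, ((C (σ k) k * (n:ℝ) ^ (n-1)) * (1 + |s (σ k)|) ^ (n-1) * (H (Fin.rev (σ k)) / H k)) :=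
        Finset.prod_le_prod (fun _ _ => norm_nonneg _) fun k _ => hent (σ k) k
    _ = (∏ k, (C (σ k) k * (n:ℝ) ^ (n-1))) * (∏ k, (1 + |s (σ k)|) ^ (n-1)) *
          ((∏ k, H (Fin.rev (σ k))) / ∏ k, H k) := by
        rw [Finset.prod_mul_distrib, Finset.prod_mul_distrib, Finset.prod_div_distrib]
    _ = _ := by
        have e1 : ∏ k, H (Fin.rev (σ k)) = ∏ k, H k :=
          Equiv.prod_comp (σ.trans Fin.revPerm) H
        have e2 : ∏ k, (1 + |s (σ k)|) ^ (n-1) = ∏ k, (1 + |s k|) ^ (n-1) :=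
          Equiv.prod_comp σ (fun k => (1 + |s k|) ^ (n-1))
        rw [e1, e2, div_self (Finset.prod_pos fun k _ => hHpos k).ne', mul_one]

theorem det_bound (n : ℕ) : ∃ C : ℝ, 0 ≤ C ∧ ∀ (s : Fin n → ℝ) (L : Fin n → ℕ) (a : Fin n → ℝ),
    Function.Injective a → (∀ c, a c ≠ 0) →
    ‖(Matrix.of fun b c : Fin n => ent (Complex.I * (s b : ℝ) + ((n - 1 - (b : ℕ) : ℕ) : ℂ)) (L b) (a c)).det‖ ≤
      C * (∏ b, (1 + |s b|) ^ (n - 1)) * ‖VdmCF (fun c => ((a c : ℝ) : ℂ))‖ := by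
  obtain ⟨C, hC, h⟩ := det_bound_sorted n
  refine ⟨C, hC, ?_⟩
  intro s L a ha h0
  set σ := Tuple.sort (fun c => |a c|) with hσ
  have hm : Monotone (fun c => |(a ∘ σ) c|) := Tuple.monotone_sort (fun c => |a c|)
  have := h s L (a ∘ σ) (ha.comp σ.injective) (fun c => h0 _) hm
  have hsg : ‖((Equiv.Perm.sign σ : ℤ) : ℂ)‖ = 1 := by
    rcases Int.units_eq_one_or (Equiv.Perm.sign σ) with h | h <;> rw [h] <;> simp
  have e1 : VdmCF (fun c => (((a ∘ σ) c : ℝ) : ℂ)) =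
      ((Equiv.Perm.sign σ : ℤ) : ℂ) * VdmCF (fun c => ((a c : ℝ) : ℂ)) :=
    VdmCF_perm (fun c => ((a c : ℝ) : ℂ)) σ
  have e2 := Matrix.det_permute' σ (Matrix.of fun b c : Fin n => ent (Complex.I * (s b : ℝ) + ((n - 1 - (b : ℕ) : ℕ) : ℂ)) (L b) (a c))
  have e3 : (Matrix.of fun b c : Fin n => ent (Complex.I * (s b : ℝ) + ((n - 1 - (b : ℕ) : ℕ) : ℂ)) (L b) ((a ∘ σ) c)) =
    (Matrix.of fun b c : Fin n => ent (Complex.I * (s b : ℝ) + ((n - 1 - (b : ℕ) : ℕ) : ℂ)) (L b) (a c)).submatrix id σ := by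
    ext b c; simp
  rw [e3, e2, e1, norm_mul, norm_mul, hsg, one_mul, one_mul] at this
  exact this

/-- `∫_{-1}^1 cos(πx/2)^m cos(zx) dx`. -/
def cosI (m : ℕ) (z : ℝ) : ℝ := ∫ x in (-1:ℝ)..1, Real.cos (Real.pi / 2 * x) ^ m * Real.cos (z * x)

theorem cosI_continuous (m : ℕ) : Continuous (cosI m) := by
  unfold cosI
  apply intervalIntegral.continuous_parametric_intervalIntegral_of_continuous'
  unfold Function.uncurry
  fun_prop

theorem cosI_one (z : ℝ) : ((Real.pi/2)^2 - z^2) * cosI 1 z = Real.pi * Real.cos z := by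
  have h : ∀ x ∈ Set.uIcc (-1:ℝ) 1, HasDerivAt
      (fun x => -z * Real.cos (Real.pi / 2 * x) * Real.sin (z * x) +
        Real.pi / 2 * Real.sin (Real.pi / 2 * x) * Real.cos (z * x))
      (((Real.pi/2)^2 - z^2) * (Real.cos (Real.pi / 2 * x) ^ 1 * Real.cos (z * x))) x := by
    intro x _
    have h1 : HasDerivAt (fun x : ℝ => Real.cos (Real.pi / 2 * x)) (-Real.sin (Real.pi / 2 * x) * (Real.pi/2)) x := by
      simpa using ((hasDerivAt_id x).const_mul (Real.pi/2)).cos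
    have h2 : HasDerivAt (fun x : ℝ => Real.sin (Real.pi / 2 * x)) (Real.cos (Real.pi / 2 * x) * (Real.pi/2)) x := by
      simpa using ((hasDerivAt_id x).const_mul (Real.pi/2)).sin
    have h3 : HasDerivAt (fun x : ℝ => Real.cos (z * x)) (-Real.sin (z * x) * z) x := by
      simpa using ((hasDerivAt_id x).const_mul z).cos
    have h4 : HasDerivAt (fun x : ℝ => Real.sin (z * x)) (Real.cos (z * x) * z) x := by
      simpa using ((hasDerivAt_id x).const_mul z).sin
    refine (((h1.const_mul (-z)).mul h4).add ((h2.const_mul (Real.pi/2)).mul h3)).congr_deriv ?_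
    ring
  have := intervalIntegral.integral_eq_sub_of_hasDerivAt h (by
    apply Continuous.intervalIntegrable; fun_prop)
  rw [intervalIntegral.integral_const_mul] at this
  unfold cosI
  rw [this]
  simp
  ring

theorem cosI_rec (m : ℕ) (z : ℝ) : (((m:ℝ)+2)^2 * (Real.pi/2)^2 - z^2) * cosI (m+2) z =
    ((m:ℝ)+2) * ((m:ℝ)+1) * (Real.pi/2)^2 * cosI m z := by
  have h : ∀ x ∈ Set.uIcc (-1:ℝ) 1, HasDerivAt
      (fun x => -z * Real.cos (Real.pi / 2 * x) ^ (m+2) * Real.sin (z * x) +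
        ((m:ℝ)+2) * (Real.pi / 2) * (Real.cos (Real.pi / 2 * x) ^ (m+1) * Real.sin (Real.pi / 2 * x)) * Real.cos (z * x))
      ((((m:ℝ)+2)^2 * (Real.pi/2)^2 - z^2) * (Real.cos (Real.pi / 2 * x) ^ (m+2) * Real.cos (z * x)) -
        ((m:ℝ)+2) * ((m:ℝ)+1) * (Real.pi/2)^2 * (Real.cos (Real.pi / 2 * x) ^ m * Real.cos (z * x))) x := by
    intro x _
    have h1 : HasDerivAt (fun x : ℝ => Real.cos (Real.pi / 2 * x)) (-Real.sin (Real.pi / 2 * x) * (Real.pi/2)) x := by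
      simpa using ((hasDerivAt_id x).const_mul (Real.pi/2)).cos
    have h2 : HasDerivAt (fun x : ℝ => Real.sin (Real.pi / 2 * x)) (Real.cos (Real.pi / 2 * x) * (Real.pi/2)) x := by
      simpa using ((hasDerivAt_id x).const_mul (Real.pi/2)).sin
    have h3 : HasDerivAt (fun x : ℝ => Real.cos (z * x)) (-Real.sin (z * x) * z) x := by
      simpa using ((hasDerivAt_id x).const_mul z).cos
    have h4 : HasDerivAt (fun x : ℝ => Real.sin (z * x)) (Real.cos (z * x) * z) x := by
      simpa using ((hasDerivAt_id x).const_mul z).sin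
    have h5 := h1.pow (m+2)
    have h6 := h1.pow (m+1)
    refine (((h5.const_mul (-z)).mul h4).add
      (((h6.mul h2).const_mul (((m:ℝ)+2) * (Real.pi / 2))).mul h3)).congr_deriv ?_
    simp only [Nat.add_sub_cancel, Nat.cast_add, Nat.cast_one, Nat.cast_ofNat, Pi.mul_apply, Pi.pow_apply]
    have hs : Real.sin (Real.pi / 2 * x) ^ 2 = 1 - Real.cos (Real.pi / 2 * x) ^ 2 := by
      rw [← Real.sin_sq_add_cos_sq (Real.pi / 2 * x)]; ring
    have e1 : m + 2 - 1 = m + 1 := by omega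
    rw [e1]
    linear_combination (((m:ℝ)+2) * ((m:ℝ)+1) * (Real.pi/2)^2) * (-Real.cos (Real.pi / 2 * x) ^ m * Real.cos (z * x)) * hs
  have := intervalIntegral.integral_eq_sub_of_hasDerivAt h (by
    apply Continuous.intervalIntegrable; fun_prop)
  rw [intervalIntegral.integral_sub (by apply Continuous.intervalIntegrable; fun_prop)
    (by apply Continuous.intervalIntegrable; fun_prop), intervalIntegral.integral_const_mul,
    intervalIntegral.integral_const_mul] at this
  unfold cosI
  simp at this
  linarith

/-- The denominator of `ζ_n`. -/
def zden (n : ℕ) (z : ℝ) : ℝ :=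
  ∏ k ∈ Finset.range n, (1 - 4 * z ^ 2 / (Real.pi * (2 * (k : ℝ) + 1)) ^ 2)

theorem zden_mul_cosI (r : ℕ) : ∃ c : ℝ, ∀ z, zden (r+1) z * cosI (2*r+1) z = c * Real.cos z := by
  have hpi := Real.pi_pos
  induction r with
  | zero =>
    refine ⟨4 / Real.pi, fun z => ?_⟩
    have := cosI_one z
    simp only [zden, zero_add, Finset.prod_range_one, Nat.cast_zero, mul_zero]
    have e : (1 - 4 * z ^ 2 / (Real.pi * 1) ^ 2) = ((Real.pi/2)^2 - z^2) * (4 / Real.pi^2) := by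
      field_simp; ring
    rw [e]
    have : ((Real.pi/2)^2 - z^2) * (4 / Real.pi^2) * cosI 1 z = (4 / Real.pi^2) * (((Real.pi/2)^2 - z^2) * cosI 1 z) := by ring
    rw [this, cosI_one]
    field_simp
  | succ r ih =>
    obtain ⟨c, hc⟩ := ih
    refine ⟨4 / (Real.pi * (2 * ((r+1:ℕ):ℝ) + 1))^2 * ((((2*r+1:ℕ):ℝ)+2) * (((2*r+1:ℕ):ℝ)+1) * (Real.pi/2)^2) * c, fun z => ?_⟩
    have h1 := cosI_rec (2*r+1) z
    have hz : zden (r+1+1) z = zden (r+1) z * (1 - 4 * z ^ 2 / (Real.pi * (2 * ((r+1:ℕ) : ℝ) + 1)) ^ 2) := by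
      rw [zden, Finset.prod_range_succ]; rfl
    have e : (1 - 4 * z ^ 2 / (Real.pi * (2 * ((r+1:ℕ) : ℝ) + 1)) ^ 2) =
        4 / (Real.pi * (2 * ((r+1:ℕ):ℝ) + 1))^2 * ((((2*r+1:ℕ):ℝ)+2)^2 * (Real.pi/2)^2 - z^2) := by
      push_cast
      field_simp
      ring
    rw [hz, e]
    have e2 : 2 * (r+1) + 1 = 2*r+1+2 := by ring
    rw [e2]
    linear_combination (zden (r+1) z * (4 / (Real.pi * (2 * ((r+1:ℕ):ℝ) + 1))^2)) * h1 +
      (4 / (Real.pi * (2 * ((r+1:ℕ):ℝ) + 1))^2 * ((((2*r+1:ℕ):ℝ)+2) * (((2*r+1:ℕ):ℝ)+1) * (Real.pi/2)^2)) * hc z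

theorem cos_pos_of (x : ℝ) (hx : x ∈ Set.Ioo (-1:ℝ) 1) : 0 < Real.cos (Real.pi / 2 * x) := by
  have hpi := Real.pi_pos
  apply Real.cos_pos_of_mem_Ioo
  constructor <;> nlinarith [hx.1, hx.2]

theorem cosI_zero_pos (m : ℕ) : 0 < cosI m 0 := by
  unfold cosI
  apply intervalIntegral.intervalIntegral_pos_of_pos_on
  · apply Continuous.intervalIntegrable; fun_prop
  · intro x hx
    simp only [zero_mul, Real.cos_zero, mul_one]
    exact pow_pos (cos_pos_of x hx) _
  · norm_num

theorem zden_mul (r : ℕ) (z : ℝ) : zden (r+1) z * cosI (2*r+1) z = cosI (2*r+1) 0 * Real.cos z := by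
  obtain ⟨c, hc⟩ := zden_mul_cosI r
  have h0 := hc 0
  have : zden (r+1) 0 = 1 := by simp [zden]
  rw [this, one_mul, Real.cos_zero, mul_one] at h0
  rw [hc, h0]

theorem zden_finite (n : ℕ) : {z : ℝ | zden n z = 0}.Finite := by
  have hpi := Real.pi_pos
  refine Set.Finite.subset (Finset.finite_toSet
    ((Finset.range n).image (fun k : ℕ => Real.pi * (2 * (k:ℝ) + 1) / 2) ∪
     (Finset.range n).image (fun k : ℕ => -(Real.pi * (2 * (k:ℝ) + 1) / 2)))) ?_
  intro z hz
  simp only [Set.mem_setOf_eq, zden, Finset.prod_eq_zero_iff] at hz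
  obtain ⟨k, hk, h⟩ := hz
  have hp : 0 < Real.pi * (2 * (k:ℝ) + 1) := by positivity
  have h2 : z^2 = (Real.pi * (2 * (k:ℝ) + 1) / 2)^2 := by
    field_simp at h ⊢
    linarith
  simp only [Finset.coe_union, Finset.coe_image, Set.mem_union, Set.mem_image, Finset.mem_coe]
  rcases sq_eq_sq_iff_eq_or_eq_neg.1 h2 with h3 | h3
  · exact Or.inl ⟨k, hk, h3.symm⟩
  · exact Or.inr ⟨k, hk, h3.symm⟩

theorem zetaRaw_eq (r : ℕ) (z : ℝ) (hz : zden (r+1) z ≠ 0) :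
    zetaRaw (r+1) z = cosI (2*r+1) z / cosI (2*r+1) 0 := by
  have h0 := (cosI_zero_pos (2*r+1)).ne'
  have : zetaRaw (r+1) z = Real.cos z / zden (r+1) z := rfl
  rw [this, div_eq_div_iff hz h0]
  linarith [zden_mul r z]

theorem zetaReg_eq (r : ℕ) (z : ℝ) :
    zetaReg (r+1) z = cosI (2*r+1) z / cosI (2*r+1) 0 := by
  unfold zetaReg
  split_ifs with h
  · exact zetaRaw_eq r z h
  · apply Filter.Tendsto.limUnder_eq
    have h1 : Tendsto (fun z => cosI (2*r+1) z / cosI (2*r+1) 0) (nhdsWithin z {z}ᶜ)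
        (nhds (cosI (2*r+1) z / cosI (2*r+1) 0)) :=
      (((cosI_continuous (2*r+1)).div_const _).tendsto z).mono_left nhdsWithin_le_nhds
    refine h1.congr' ?_
    have hf : ({w : ℝ | zden (r+1) w = 0} \ {z}).Finite := (zden_finite (r+1)).subset Set.diff_subset
    have hmem : ({w : ℝ | zden (r+1) w = 0} \ {z})ᶜ ∈ nhds z :=
      hf.isClosed.isOpen_compl.mem_nhds (by simp)
    filter_upwards [mem_nhdsWithin_of_mem_nhds hmem, self_mem_nhdsWithin] with w hw hwz
    rw [zetaRaw_eq]
    intro h0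
    exact hw ⟨h0, hwz⟩

theorem zetaReg_continuous (n : ℕ) (hn : 1 ≤ n) : Continuous (zetaReg n) := by
  obtain ⟨r, rfl⟩ : ∃ r, n = r + 1 := ⟨n - 1, by omega⟩
  have : zetaReg (r+1) = fun z => cosI (2*r+1) z / cosI (2*r+1) 0 := funext (zetaReg_eq r)
  rw [this]
  exact (cosI_continuous _).div_const _

/-- The kernel, Fourier dual to `ζ_n`. -/
def kerK (n : ℕ) (x : ℝ) : ℝ :=
  if |x| ≤ 1 then Real.cos (Real.pi / 2 * x) ^ (2*(n-1)+1) / cosI (2*(n-1)+1) 0 else 0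

theorem kerK_continuous (n : ℕ) : Continuous (kerK n) := by
  unfold kerK
  apply Continuous.if_le
  · fun_prop
  · fun_prop
  · fun_prop
  · fun_prop
  · intro x hx
    have : Real.cos (Real.pi / 2 * x) = 0 := by
      rcases abs_eq (by norm_num : (0:ℝ) ≤ 1) |>.1 hx with h | h <;> rw [h] <;> simp
    rw [this]; simp

theorem kerK_nonneg (n : ℕ) (x : ℝ) : 0 ≤ kerK n x := by
  unfold kerK
  split_ifs with h
  · rw [abs_le] at h
    have hpi := Real.pi_pos
    have : 0 ≤ Real.cos (Real.pi / 2 * x) := by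
      apply Real.cos_nonneg_of_mem_Icc
      constructor <;> nlinarith
    have := (cosI_zero_pos (2*(n-1)+1)).le
    positivity
  · exact le_rfl

theorem kerK_le (n : ℕ) (x : ℝ) : kerK n x ≤ (cosI (2*(n-1)+1) 0)⁻¹ := by
  have hp := (cosI_zero_pos (2*(n-1)+1))
  unfold kerK
  split_ifs with h
  · rw [abs_le] at h
    have hpi := Real.pi_pos
    have : 0 ≤ Real.cos (Real.pi / 2 * x) := by
      apply Real.cos_nonneg_of_mem_Icc
      constructor <;> nlinarith
    rw [div_eq_mul_inv]
    apply mul_le_of_le_one_left (by positivity)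
    exact pow_le_one₀ this (Real.cos_le_one _)
  · positivity

theorem kerK_eq_zero (n : ℕ) (x : ℝ) (hx : 1 < |x|) : kerK n x = 0 := by
  unfold kerK
  rw [if_neg (not_le.2 hx)]

theorem kerK_hasCompactSupport (n : ℕ) : HasCompactSupport (kerK n) := by
  apply HasCompactSupport.of_support_subset_isCompact (isCompact_Icc (a := (-1:ℝ)) (b := 1))
  intro x hx
  by_contra h
  apply hx
  apply kerK_eq_zero
  by_contra h'
  exact h (abs_le.1 (not_lt.1 h'))

theorem kerK_integrable (n : ℕ) : Integrable (kerK n) :=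
  (kerK_continuous n).integrable_of_hasCompactSupport (kerK_hasCompactSupport n)

theorem kerK_even (n : ℕ) (x : ℝ) : kerK n (-x) = kerK n x := by
  simp [kerK, Real.cos_neg]

theorem integral_kerK_cos (n : ℕ) (hn : 1 ≤ n) (z : ℝ) : ∫ x, kerK n x * Real.cos (z * x) = zetaReg n z := by
  obtain ⟨r, rfl⟩ : ∃ r, n = r + 1 := ⟨n - 1, by omega⟩
  rw [zetaReg_eq, cosI, intervalIntegral.integral_of_le (by norm_num), ← integral_Icc_eq_integral_Ioc,
    ← integral_div, ← integral_indicator measurableSet_Icc]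
  congr 1
  funext x
  simp only [Set.indicator, Set.mem_Icc, ← abs_le, kerK, Nat.add_sub_cancel]
  split_ifs
  · ring
  · ring

theorem integral_kerK (n : ℕ) (hn : 1 ≤ n) : ∫ x, kerK n x = 1 := by
  have := integral_kerK_cos n hn 0
  simp only [zero_mul, Real.cos_zero, mul_one] at this
  rw [this]
  obtain ⟨r, rfl⟩ : ∃ r, n = r + 1 := ⟨n - 1, by omega⟩
  rw [zetaReg_eq, div_self (cosI_zero_pos _).ne']

theorem integral_kerK_sin (n : ℕ) (z : ℝ) : ∫ x, kerK n x * Real.sin (z * x) = 0 := by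
  have h := integral_neg_eq_self (fun x => kerK n x * Real.sin (z * x)) (volume : Measure ℝ)
  simp only [kerK_even, mul_neg, Real.sin_neg, integral_neg] at h
  linarith

theorem integral_kerK_exp (n : ℕ) (hn : 1 ≤ n) (z : ℝ) :
    ∫ x : ℝ, Complex.exp (((-(z * x) : ℝ) : ℂ) * Complex.I) * (kerK n x : ℂ) = (zetaReg n z : ℂ) := by
  have e : ∀ x : ℝ, Complex.exp (((-(z * x) : ℝ) : ℂ) * Complex.I) * (kerK n x : ℂ) =
      ((kerK n x * Real.cos (z * x) : ℝ) : ℂ) - ((kerK n x * Real.sin (z * x) : ℝ) : ℂ) * Complex.I := by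
    intro x
    rw [Complex.exp_mul_I, ← Complex.ofReal_cos, ← Complex.ofReal_sin, Real.cos_neg, Real.sin_neg]
    push_cast
    ring
  simp_rw [e]
  have i1 : Integrable (fun x => kerK n x * Real.cos (z * x)) := by
    apply Continuous.integrable_of_hasCompactSupport
    · have := kerK_continuous n; fun_prop
    · exact (kerK_hasCompactSupport n).mul_right
  have i2 : Integrable (fun x => kerK n x * Real.sin (z * x)) := by
    apply Continuous.integrable_of_hasCompactSupport
    · have := kerK_continuous n; fun_prop
    · exact (kerK_hasCompactSupport n).mul_right
  rw [integral_sub i1.ofReal (i2.ofReal.mul_const _), integral_mul_const, integral_complex_ofReal,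
    integral_complex_ofReal, integral_kerK_cos n hn, integral_kerK_sin]
  simp

theorem abs_zetaReg_le_one (n : ℕ) (hn : 1 ≤ n) (z : ℝ) : |zetaReg n z| ≤ 1 := by
  rw [← integral_kerK_cos n hn, ← integral_kerK n hn]
  refine (abs_integral_le_integral_abs).trans ?_
  apply integral_mono_of_nonneg
  · exact Filter.Eventually.of_forall fun x => abs_nonneg _
  · exact kerK_integrable n
  · refine Filter.Eventually.of_forall fun x => ?_
    simp only
    rw [abs_mul, abs_of_nonneg (kerK_nonneg n x)]
    exact mul_le_of_le_one_right (kerK_nonneg n x) (Real.abs_cos_le_one _)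

theorem zden_lower (n : ℕ) (hn : 1 ≤ n) (z : ℝ) (hz : 2 * Real.pi * n ≤ |z|) :
    (z^2 / (2 * (Real.pi * n)^2)) ^ n ≤ |zden n z| := by
  have hpi := Real.pi_pos
  have hn' : (1:ℝ) ≤ n := by exact_mod_cast hn
  rw [zden, Finset.abs_prod]
  calc (z^2 / (2 * (Real.pi * n)^2)) ^ n = ∏ k ∈ Finset.range n, (z^2 / (2 * (Real.pi * n)^2)) := by
        rw [Finset.prod_const, Finset.card_range]
    _ ≤ _ := by
      refine Finset.prod_le_prod (fun _ _ => by positivity) fun k hk => ?_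
      have hk' : ((k:ℝ) + 1) ≤ n := by exact_mod_cast Finset.mem_range.1 hk
      set q := 4 * z ^ 2 / (Real.pi * (2 * (k : ℝ) + 1)) ^ 2 with hq
      have h1 : z^2 / (Real.pi * n)^2 ≤ q := by
        rw [hq, div_le_div_iff₀ (by positivity) (by positivity)]
        have : (Real.pi * (2 * (k : ℝ) + 1))^2 ≤ (Real.pi * (2 * n))^2 := by
          gcongr; linarith
        nlinarith [sq_nonneg z]
      have h2 : 4 ≤ z^2 / (Real.pi * n)^2 := by
        rw [le_div_iff₀ (by positivity), ← sq_abs z]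
        nlinarith [mul_self_le_mul_self (by positivity : 0 ≤ 2 * Real.pi * n) hz]
      have h3 : z^2 / (2 * (Real.pi * n)^2) = (z^2 / (Real.pi * n)^2) / 2 := by
        field_simp
      rw [h3, abs_sub_comm, abs_of_nonneg (by linarith)]
      linarith

theorem zetaReg_decay (n : ℕ) (hn : 1 ≤ n) : ∃ C : ℝ, 0 ≤ C ∧ ∀ z, |zetaReg n z| * (1 + |z|) ^ (2 * n) ≤ C := by
  have hpi := Real.pi_pos
  have hpi3 := Real.pi_gt_three
  have hn' : (1:ℝ) ≤ n := by exact_mod_cast hn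
  refine ⟨max ((1 + 2 * Real.pi * n) ^ (2*n)) ((2 * (Real.pi * n)^2) ^ n * 2 ^ (2*n)), by positivity, ?_⟩
  intro z
  rcases le_total |z| (2 * Real.pi * n) with h | h
  · refine le_trans ?_ (le_max_left _ _)
    calc _ ≤ 1 * (1 + 2 * Real.pi * n) ^ (2*n) := by
          gcongr
          exact abs_zetaReg_le_one n hn z
      _ = _ := one_mul _
  · refine le_trans ?_ (le_max_right _ _)
    have h1 : 1 ≤ |z| := by nlinarith
    have hlow := zden_lower n hn z h
    have hzp : 0 < z^2 := by rw [← sq_abs]; positivity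
    have hpos : 0 < (z^2 / (2 * (Real.pi * n)^2)) ^ n := by positivity
    have hne : zden n z ≠ 0 := abs_pos.1 (hpos.trans_le hlow)
    have e : zetaReg n z = Real.cos z / zden n z := by
      unfold zetaReg
      exact if_pos hne
    rw [e, abs_div]
    calc |Real.cos z| / |zden n z| * (1 + |z|)^(2*n) ≤
        1 / (z^2 / (2 * (Real.pi * n)^2)) ^ n * (2 * |z|)^(2*n) := by
          gcongr
          · exact Real.abs_cos_le_one z
          · linarith
      _ = _ := by
          have hz2 : (|z|) ^ (2*n) = (z^2)^n := by rw [pow_mul, sq_abs]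
          rw [mul_pow 2 |z|, hz2, div_pow]
          have := pow_pos hzp n
          field_simp

theorem zeta_poly_integrable (n : ℕ) (hn : 1 ≤ n) (ε : ℝ) (hε : 0 < ε) :
    Integrable (fun s : ℝ => (1 + |s|) ^ (n-1) * |zetaReg n (ε * s)|) := by
  obtain ⟨C, hC, hdec⟩ := zetaReg_decay n hn
  have hintg : Integrable (fun s : ℝ => (1 + 1/ε)^(n-1) * C * (1 + (ε * s)^2)⁻¹) :=
    ((integrable_inv_one_add_sq).comp_mul_left' hε.ne').const_mul _
  refine hintg.mono' ?_ ?_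
  · apply Continuous.aestronglyMeasurable
    have := zetaReg_continuous n hn
    fun_prop
  · refine Filter.Eventually.of_forall fun s => ?_
    rw [Real.norm_eq_abs, abs_of_nonneg (by positivity)]
    have h1 : 1 + |s| ≤ (1 + 1/ε) * (1 + |ε * s|) := by
      rw [abs_mul, abs_of_pos hε]
      have : 1/ε * (ε * |s|) = |s| := by field_simp
      have h2 : 0 ≤ 1/ε := by positivity
      have h3 : 0 ≤ ε * |s| := by positivity
      nlinarith
    have h2 := hdec (ε * s)
    set y := |ε * s| with hy
    have hy0 : 0 ≤ y := abs_nonneg _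
    have h3 : (1 + (ε*s)^2) ≤ (1 + y)^2 := by rw [← sq_abs]; nlinarith
    have h4 : (1+y)^(n-1) * (1+y)^2 ≤ (1+y)^(2*n) := by
      rw [← pow_add]
      exact pow_le_pow_right₀ (by linarith) (by omega)
    rw [← div_eq_mul_inv, le_div_iff₀ (by positivity)]
    calc (1 + |s|)^(n-1) * |zetaReg n (ε*s)| * (1 + (ε*s)^2) ≤
        ((1 + 1/ε) * (1 + y))^(n-1) * |zetaReg n (ε*s)| * (1+y)^2 := by gcongr
      _ = (1 + 1/ε)^(n-1) * (|zetaReg n (ε*s)| * ((1+y)^(n-1) * (1+y)^2)) := by rw [mul_pow]; ring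
      _ ≤ (1 + 1/ε)^(n-1) * (|zetaReg n (ε*s)| * (1+y)^(2*n)) := by gcongr
      _ ≤ _ := by gcongr

theorem zeta_integrable (n : ℕ) (hn : 1 ≤ n) (ε : ℝ) (hε : 0 < ε) :
    Integrable (fun s : ℝ => zetaReg n (ε * s)) := by
  refine (zeta_poly_integrable n hn ε hε).mono' ?_ ?_
  · apply Continuous.aestronglyMeasurable
    have := zetaReg_continuous n hn
    fun_prop
  · refine Filter.Eventually.of_forall fun s => ?_
    rw [Real.norm_eq_abs]
    refine le_mul_of_one_le_left (abs_nonneg _) (one_le_pow₀ (by linarith [abs_nonneg s]))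

open FourierTransform in
theorem zeta_fourier (n : ℕ) (hn : 1 ≤ n) (ε : ℝ) (hε : 0 < ε) (x : ℝ) :
    ∫ s : ℝ, (zetaReg n (ε * s) : ℂ) * Complex.exp (((s * x : ℝ) : ℂ) * Complex.I) =
      ((2 * Real.pi * (kerK n (x / ε) / ε) : ℝ) : ℂ) := by
  have hpi := Real.pi_pos
  have hF : 𝓕 (fun x => (kerK n x : ℂ)) = fun v => (zetaReg n (2 * Real.pi * v) : ℂ) := by
    funext v
    rw [Real.fourier_real_eq_integral_exp_smul, ← integral_kerK_exp n hn]
    congr 1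
    funext y
    rw [smul_eq_mul]
    congr 4
    ring
  have hinv := Continuous.fourierInv_fourier_eq (f := fun x => (kerK n x : ℂ))
    (Complex.continuous_ofReal.comp (kerK_continuous n)) (kerK_integrable n).ofReal
    (by rw [hF]; exact (zeta_integrable n hn (2 * Real.pi) (by positivity)).ofReal)
  have h := congrFun hinv (x / ε)
  rw [hF, Real.fourierInv_eq'] at h
  simp only [smul_eq_mul] at h
  have hsub := Measure.integral_comp_mul_left (fun v : ℝ => Complex.exp ((↑(2 * Real.pi * inner ℝ v (x/ε)) * Complex.I)) * (zetaReg n (2 * Real.pi * v) : ℂ)) (ε / (2 * Real.pi))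
  rw [h] at hsub
  have e : ∀ s : ℝ, Complex.exp ((↑(2 * Real.pi * inner ℝ (ε / (2 * Real.pi) * s) (x/ε)) * Complex.I)) * (zetaReg n (2 * Real.pi * (ε / (2 * Real.pi) * s)) : ℂ) = (zetaReg n (ε * s) : ℂ) * Complex.exp (((s * x : ℝ) : ℂ) * Complex.I) := by
    intro s
    have e1 : 2 * Real.pi * inner ℝ (ε / (2 * Real.pi) * s) (x/ε) = s * x := by
      simp only [RCLike.inner_apply, conj_trivial]
      field_simp
    have e2 : 2 * Real.pi * (ε / (2 * Real.pi) * s) = ε * s := by field_simp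
    rw [e1, e2, mul_comm]
  simp_rw [e] at hsub
  rw [hsub, abs_of_pos (by positivity), Complex.real_smul, ← Complex.ofReal_mul]
  congr 1
  field_simp

/-- The exceptional set of the `a`-integrand. -/
def badA {n : ℕ} (a : Fin n → ℝ) : Prop := (∃ c, a c = 0) ∨ ∃ c d, c ≠ d ∧ a c = a d

/-- First determinant. -/
def det1 (n : ℕ) (L : Fin n → ℕ) (s a : Fin n → ℝ) : ℂ :=
  (Matrix.of fun b c : Fin n =>
    ent (Complex.I * (s b : ℝ) + ((n - 1 - (b : ℕ) : ℕ) : ℂ)) (L b) (a c)).det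

/-- Normalised first determinant. -/
def detD (n : ℕ) (L : Fin n → ℕ) (s a : Fin n → ℝ) : ℂ :=
  if badA a then 0 else det1 n L s a / VdmCF (fun c => ((a c : ℝ) : ℂ))

/-- Second determinant. -/
def det2 (n : ℕ) (L : Fin n → ℕ) (s a : Fin n → ℝ) : ℂ :=
  (Matrix.of fun b c : Fin n =>
    ent (-(Complex.I * (s b : ℝ)) + (((b : ℕ) : ℤ) - (n : ℤ) : ℤ)) (L b) (a c)).det

theorem sShift_injective (n : ℕ) (s : Fin n → ℝ) : Function.Injective (sShift n s) := by
  intro b c h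
  have h2 := congrArg Complex.re h
  simp [sShift] at h2
  have := b.2
  have := c.2
  ext
  omega

theorem not_badA {n : ℕ} {a : Fin n → ℝ} (h : ¬ badA a) :
    Function.Injective a ∧ ∀ c, a c ≠ 0 := by
  unfold badA at h
  push Not at h
  exact ⟨fun c d hcd => by_contra fun hne => h.2 c d hne hcd, h.1⟩

theorem invIntegrand_eq (n : ℕ) (p : (Fin n → ℝ) → ℝ) (a : Fin n → ℝ) (L : Fin n → Fin 2) (ε : ℝ)
    (s : Fin n → ℝ) :
    invIntegrand n p a L ε s = (∏ j ∈ Finset.range n, (Nat.factorial j : ℂ)) *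
      ((∫ x : Fin n → ℝ, (p x : ℂ) * detD n (fun b => (L b : ℕ)) s x) *
        ((∏ l : Fin n, ((zetaReg n (ε * s l) : ℝ) : ℂ)) * det2 n (fun b => (L b : ℕ)) s a)) := by
  have hV : VdmCF (sShift n s) ≠ 0 := VdmCF_ne_zero _ (sShift_injective n s)
  have e : ∀ x : Fin n → ℝ, (p x : ℂ) *
        (if (∃ c, x c = 0) ∨ ∃ c d, c ≠ d ∧ x c = x d then 0
         else
           Matrix.det (Matrix.of fun b c : Fin n =>
             ((Real.sign (x c) : ℝ) : ℂ) ^ (L b : ℕ) *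
               ((|x c| : ℝ) : ℂ) ^ (Complex.I * (s b : ℝ) + ((n - 1 - (b : ℕ) : ℕ) : ℂ))) /
             (VdmCF (fun c => ((x c : ℝ) : ℂ)) * VdmCF (sShift n s)))
      = ((p x : ℂ) * detD n (fun b => (L b : ℕ)) s x) * (VdmCF (sShift n s))⁻¹ := by
    intro x
    unfold detD det1 ent badA
    split_ifs
    · simp
    · field_simp
  unfold invIntegrand spTrans
  simp_rw [e]
  rw [integral_mul_const]
  unfold det2 ent
  field_simp

theorem measurable_sign' : Measurable Real.sign := by
  have : Real.sign = fun r : ℝ => if r < 0 then (-1:ℝ) else if 0 < r then 1 else 0 := by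
    funext r; rfl
  rw [this]
  refine Measurable.ite measurableSet_Iio measurable_const ?_
  exact Measurable.ite measurableSet_Ioi measurable_const measurable_const

theorem measurable_ent {α : Type*} [MeasurableSpace α] {f : α → ℂ} {g : α → ℝ} (hf : Measurable f)
    (hg : Measurable g) (L : ℕ) : Measurable fun x => ent (f x) L (g x) := by
  unfold ent
  refine Measurable.mul ?_ ?_
  · exact (Complex.measurable_ofReal.comp (measurable_sign'.comp hg)).pow_const _
  · exact (Complex.measurable_ofReal.comp (hg.abs)).pow hf

theorem measurable_det' {α : Type*} [MeasurableSpace α] {n : ℕ} {M : α → Fin n → Fin n → ℂ}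
    (h : ∀ b c, Measurable fun x => M x b c) : Measurable fun x => (Matrix.of (M x)).det := by
  simp_rw [Matrix.det_apply']
  refine Finset.measurable_sum _ fun σ _ => Measurable.const_mul ?_ _
  exact Finset.measurable_prod _ fun i _ => h _ _

theorem measurable_VdmCF {n : ℕ} : Measurable fun a : Fin n → ℝ => VdmCF (fun c => ((a c : ℝ) : ℂ)) := by
  unfold VdmCF
  fun_prop

theorem measurableSet_badA {n : ℕ} : MeasurableSet {a : Fin n → ℝ | badA a} := by
  have : {a : Fin n → ℝ | badA a} = (⋃ c, {a | a c = 0}) ∪ ⋃ c, ⋃ d, ⋃ (_ : c ≠ d), {a | a c = a d} := by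
    ext a; simp [badA]
  rw [this]
  refine MeasurableSet.union (MeasurableSet.iUnion fun c => ?_) (MeasurableSet.iUnion fun c =>
    MeasurableSet.iUnion fun d => MeasurableSet.iUnion fun _ => ?_)
  · exact measurableSet_eq_fun (measurable_pi_apply c) measurable_const
  · exact measurableSet_eq_fun (measurable_pi_apply c) (measurable_pi_apply d)

theorem measurable_det1 (n : ℕ) (L : Fin n → ℕ) :
    Measurable fun q : (Fin n → ℝ) × (Fin n → ℝ) => det1 n L q.1 q.2 := by
  refine measurable_det' fun b c => measurable_ent ?_ ?_ _ <;> fun_prop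

theorem measurable_detD (n : ℕ) (L : Fin n → ℕ) :
    Measurable fun q : (Fin n → ℝ) × (Fin n → ℝ) => detD n L q.1 q.2 := by
  unfold detD
  refine Measurable.ite (measurable_snd measurableSet_badA) measurable_const ?_
  exact (measurable_det1 n L).div (measurable_VdmCF.comp measurable_snd)

theorem measurable_det2 (n : ℕ) (L : Fin n → ℕ) (a : Fin n → ℝ) :
    Measurable fun s : Fin n → ℝ => det2 n L s a := by
  refine measurable_det' fun b c => measurable_ent ?_ measurable_const _
  fun_prop

theorem detD_bound (n : ℕ) : ∃ C : ℝ, 0 ≤ C ∧ ∀ (L : Fin n → ℕ) s a,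
    ‖detD n L s a‖ ≤ C * ∏ b, (1 + |s b|) ^ (n - 1) := by
  obtain ⟨C, hC, h⟩ := det_bound n
  refine ⟨C, hC, fun L s a => ?_⟩
  unfold detD
  split_ifs with hb
  · simp; positivity
  · obtain ⟨h1, h2⟩ := not_badA hb
    have hV : VdmCF (fun c => ((a c : ℝ) : ℂ)) ≠ 0 :=
      VdmCF_ne_zero _ (fun c d hcd => h1 (by exact_mod_cast hcd))
    rw [norm_div, div_le_iff₀ (norm_pos_iff.2 hV)]
    exact h s L a h1 h2

theorem norm_det_le' {n : ℕ} (M : Fin n → Fin n → ℂ) (B : Fin n → Fin n → ℝ)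
    (h : ∀ b c, ‖M b c‖ ≤ B b c) :
    ‖(Matrix.of M).det‖ ≤ ∑ σ : Equiv.Perm (Fin n), ∏ i, B (σ i) i := by
  rw [Matrix.det_apply']
  refine (norm_sum_le _ _).trans (Finset.sum_le_sum fun σ _ => ?_)
  rw [norm_mul, norm_prod]
  have : ‖(((Equiv.Perm.sign σ : ℤˣ) : ℤ) : ℂ)‖ = 1 := by
    rcases Int.units_eq_one_or (Equiv.Perm.sign σ) with h | h <;> simp [h]
  rw [this, one_mul]
  exact Finset.prod_le_prod (fun _ _ => norm_nonneg _) fun i _ => h _ _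

theorem norm_ent_le (z : ℂ) (L : ℕ) (x : ℝ) (hz : z ≠ 0) : ‖ent z L x‖ ≤ |x| ^ z.re := by
  unfold ent
  rw [norm_mul]
  calc _ ≤ 1 * |x| ^ z.re := by
        refine mul_le_mul (norm_sign_pow_le x L) ?_ (norm_nonneg _) zero_le_one
        by_cases hx : x = 0
        · subst hx
          simp [Complex.zero_cpow hz]
          exact Real.zero_rpow_nonneg _
        · rw [Complex.norm_cpow_eq_rpow_re_of_pos (abs_pos.2 hx)]
    _ = _ := one_mul _

theorem det2_bound (n : ℕ) (a : Fin n → ℝ) : ∃ C : ℝ, 0 ≤ C ∧ ∀ (L : Fin n → ℕ) s,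
    ‖det2 n L s a‖ ≤ C := by
  refine ⟨∑ σ : Equiv.Perm (Fin n), ∏ i, |a i| ^ (((((σ i : Fin n) : ℕ) : ℤ) - (n : ℤ) : ℤ) : ℝ), ?_, fun L s => ?_⟩
  · exact Finset.sum_nonneg fun σ _ => Finset.prod_nonneg fun i _ => by positivity
  · refine norm_det_le' _ (fun b c => |a c| ^ ((((b : ℕ) : ℤ) - (n : ℤ) : ℤ) : ℝ)) fun b c => ?_
    have hre : (-(Complex.I * (s b : ℝ)) + (((b : ℕ) : ℤ) - (n : ℤ) : ℤ) : ℂ).re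
        = ((((b : ℕ) : ℤ) - (n : ℤ) : ℤ) : ℝ) := by simp
    refine (norm_ent_le _ _ _ ?_).trans (by rw [hre])
    intro h0
    rw [h0] at hre
    have hb := b.2
    have : (((b : ℕ) : ℤ) - (n : ℤ) : ℤ) = 0 := by exact_mod_cast hre.symm
    omega

theorem zprod_integrable (n : ℕ) (hn : 1 ≤ n) (ε : ℝ) (hε : 0 < ε) :
    Integrable fun s : Fin n → ℝ => ∏ l, ((1 + |s l|) ^ (n - 1) * |zetaReg n (ε * s l)|) :=
  Integrable.fintype_prod (f := fun (_ : Fin n) (t : ℝ) => (1 + |t|) ^ (n - 1) * |zetaReg n (ε * t)|)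
    fun _ => zeta_poly_integrable n hn ε hε

/-- Joint integrability in `(s, x)`. -/
theorem joint_integrable (n : ℕ) (hn : 1 ≤ n) (p : (Fin n → ℝ) → ℝ) (hp : Integrable p)
    (a : Fin n → ℝ) (L : Fin n → ℕ) (ε : ℝ) (hε : 0 < ε) :
    Integrable (fun q : (Fin n → ℝ) × (Fin n → ℝ) => (p q.2 : ℂ) * detD n L q.1 q.2 *
      ((∏ l : Fin n, ((zetaReg n (ε * q.1 l) : ℝ) : ℂ)) * det2 n L q.1 a)) (volume.prod volume) := by
  obtain ⟨C1, hC1, h1⟩ := detD_bound n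
  obtain ⟨C2, hC2, h2⟩ := det2_bound n a
  have hz := zetaReg_continuous n hn
  have hd : Integrable (fun q : (Fin n → ℝ) × (Fin n → ℝ) =>
      (C1 * C2 * ∏ l, ((1 + |q.1 l|) ^ (n - 1) * |zetaReg n (ε * q.1 l)|)) * p q.2) (volume.prod volume) :=
    ((zprod_integrable n hn ε hε).const_mul _).mul_prod hp
  refine hd.mono ?_ (Eventually.of_forall fun q => ?_)
  · refine AEStronglyMeasurable.mul (AEStronglyMeasurable.mul ?_ ?_) ?_
    · exact Complex.continuous_ofReal.comp_aestronglyMeasurable hp.1.comp_snd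
    · exact (measurable_detD n L).aestronglyMeasurable
    · refine Measurable.aestronglyMeasurable (Measurable.mul ?_ ?_)
      · have : Continuous fun q : (Fin n → ℝ) × (Fin n → ℝ) => ∏ l : Fin n, ((zetaReg n (ε * q.1 l) : ℝ) : ℂ) := by
          refine continuous_finsetProd _ fun l _ => Complex.continuous_ofReal.comp (hz.comp ?_)
          fun_prop
        exact this.measurable
      · exact (measurable_det2 n L a).comp measurable_fst
  · simp only [norm_mul, norm_prod, Complex.norm_real, Real.norm_eq_abs, Finset.prod_mul_distrib, abs_mul, Finset.abs_prod, abs_abs,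
      abs_of_nonneg hC1, abs_of_nonneg hC2, abs_pow]
    have e : ∀ t : ℝ, abs (1 + |t|) = 1 + |t| := fun t => abs_of_nonneg (by positivity)
    simp only [e]
    calc |p q.2| * ‖detD n L q.1 q.2‖ * ((∏ l, |zetaReg n (ε * q.1 l)|) * ‖det2 n L q.1 a‖)
        ≤ |p q.2| * (C1 * ∏ b, (1 + |q.1 b|) ^ (n - 1)) * ((∏ l, |zetaReg n (ε * q.1 l)|) * C2) := by
          have hh1 := h1 L q.1 q.2
          have hh2 := h2 L q.1
          gcongr
      _ = _ := by ring

theorem invIntegrand_integrable (n : ℕ) (hn : 1 ≤ n) (p : (Fin n → ℝ) → ℝ) (hp : Integrable p)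
    (ε : ℝ) (hε : 0 < ε) (L : Fin n → Fin 2) (a : Fin n → ℝ) : Integrable (invIntegrand n p a L ε) := by
  have h := (joint_integrable n hn p hp a (fun b => (L b : ℕ)) ε hε).integral_prod_left
  simp only [integral_mul_const] at h
  have := h.const_mul (∏ j ∈ Finset.range n, (Nat.factorial j : ℂ))
  refine this.congr (Eventually.of_forall fun s => ?_)
  simp only [invIntegrand_eq]

/-- Fubini for the inverse transform. -/
theorem integral_invIntegrand (n : ℕ) (hn : 1 ≤ n) (p : (Fin n → ℝ) → ℝ) (hp : Integrable p)
    (ε : ℝ) (hε : 0 < ε) (L : Fin n → Fin 2) (a : Fin n → ℝ) :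
    ∫ s, invIntegrand n p a L ε s = (∏ j ∈ Finset.range n, (Nat.factorial j : ℂ)) *
      ∫ x : Fin n → ℝ, (p x : ℂ) * ∫ s : Fin n → ℝ, detD n (fun b => (L b : ℕ)) s x *
        ((∏ l : Fin n, ((zetaReg n (ε * s l) : ℝ) : ℂ)) * det2 n (fun b => (L b : ℕ)) s a) := by
  simp_rw [invIntegrand_eq]
  rw [integral_const_mul]
  congr 1
  simp_rw [← integral_mul_const]
  rw [integral_integral_swap (joint_integrable n hn p hp a (fun b => (L b : ℕ)) ε hε)]
  simp_rw [mul_assoc, integral_const_mul]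

theorem integral_invIntegrand_int (n : ℕ) (hn : 1 ≤ n) (p : (Fin n → ℝ) → ℝ) (hp : Integrable p)
    (ε : ℝ) (hε : 0 < ε) (L : Fin n → Fin 2) (a : Fin n → ℝ) :
    Integrable fun x : Fin n → ℝ => (p x : ℂ) * ∫ s : Fin n → ℝ, detD n (fun b => (L b : ℕ)) s x *
        ((∏ l : Fin n, ((zetaReg n (ε * s l) : ℝ) : ℂ)) * det2 n (fun b => (L b : ℕ)) s a) := by
  have h := (joint_integrable n hn p hp a (fun b => (L b : ℕ)) ε hε).integral_prod_right
  simp only [mul_assoc, integral_const_mul] at h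
  exact h

/-- Multiplicative approximate identity. -/
def kt (n : ℕ) (ε x y : ℝ) : ℝ := if 0 < x * y then kerK n (Real.log (x / y) / ε) / ε / |x| else 0

theorem cpow_exp_form (x : ℝ) (hx : x ≠ 0) (s : ℝ) (m : ℤ) :
    ((|x| : ℝ) : ℂ) ^ (Complex.I * (s : ℝ) + (m : ℂ)) =
      Complex.exp (((s * Real.log x : ℝ) : ℂ) * Complex.I) * ((|x| ^ m : ℝ) : ℂ) := by
  have h0 : ((|x| : ℝ) : ℂ) ≠ 0 := by exact_mod_cast (abs_ne_zero.2 hx)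
  rw [Complex.cpow_add _ _ h0, Complex.cpow_intCast, Complex.cpow_def_of_ne_zero h0,
    ← Complex.ofReal_log (abs_nonneg x), Real.log_abs]
  congr 1
  · congr 1; push_cast; ring
  · push_cast; rfl

theorem ent_mul_ent (n : ℕ) (b : Fin n) (x y : ℝ) (hx : x ≠ 0) (hy : y ≠ 0) (s : ℝ) (l : ℕ) :
    ent (Complex.I * (s : ℝ) + ((n - 1 - (b : ℕ) : ℕ) : ℂ)) l x *
      ent (-(Complex.I * (s : ℝ)) + (((b : ℕ) : ℤ) - (n : ℤ) : ℤ)) l y =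
    ((((Real.sign x * Real.sign y) ^ l * (|x| / |y|) ^ (n - 1 - (b : ℕ)) / |y|) : ℝ) : ℂ) *
      Complex.exp (((s * Real.log (x / y) : ℝ) : ℂ) * Complex.I) := by
  have hb := b.2
  have e1 := cpow_exp_form x hx s ((n - 1 - (b : ℕ) : ℕ) : ℤ)
  have e2 := cpow_exp_form y hy (-s) (((b : ℕ) : ℤ) - (n : ℤ))
  have e3 : (((b : ℕ) : ℤ) - (n : ℤ)) = -(((n - 1 - (b : ℕ) : ℕ) : ℤ) + 1) := by omega
  have hy' : (|y| : ℝ) ≠ 0 := abs_ne_zero.2 hy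
  unfold ent
  rw [show (Complex.I * (s : ℝ) + ((n - 1 - (b : ℕ) : ℕ) : ℂ))
      = (Complex.I * (s : ℝ) + (((n - 1 - (b : ℕ) : ℕ) : ℤ) : ℂ)) by push_cast; rfl, e1,
    show (-(Complex.I * (s : ℝ)) + ((((b : ℕ) : ℤ) - (n : ℤ) : ℤ) : ℂ)) =
      (Complex.I * ((-s : ℝ) : ℂ) + ((((b : ℕ) : ℤ) - (n : ℤ) : ℤ) : ℂ)) by push_cast; ring, e2, e3]
  have ee : Complex.exp (((s * Real.log (x / y) : ℝ) : ℂ) * Complex.I) =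
      Complex.exp (((s * Real.log x : ℝ) : ℂ) * Complex.I) *
      Complex.exp (((-s * Real.log y : ℝ) : ℂ) * Complex.I) := by
    rw [← Complex.exp_add, Real.log_div hx hy]
    congr 1; push_cast; ring
  rw [ee]
  have hr : (|y| : ℝ) ^ (-(((n - 1 - (b : ℕ) : ℕ) : ℤ) + 1)) = (|y| ^ (n - 1 - (b : ℕ)) * |y|)⁻¹ := by
    rw [zpow_neg, zpow_add₀ hy', zpow_natCast, zpow_one]
  rw [hr, zpow_natCast, div_pow, mul_pow]
  have hyc : ((|y| : ℝ) : ℂ) ≠ 0 := by exact_mod_cast hy'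
  push_cast
  field_simp

theorem zent_integrable (n : ℕ) (hn : 1 ≤ n) (ε : ℝ) (hε : 0 < ε) (b : Fin n) (x y : ℝ) (hx : x ≠ 0)
    (hy : y ≠ 0) (l : ℕ) : Integrable fun s : ℝ => ((zetaReg n (ε * s) : ℝ) : ℂ) *
      (ent (Complex.I * (s : ℝ) + ((n - 1 - (b : ℕ) : ℕ) : ℂ)) l x *
      ent (-(Complex.I * (s : ℝ)) + (((b : ℕ) : ℤ) - (n : ℤ) : ℤ)) l y) := by
  simp_rw [ent_mul_ent n b x y hx hy]
  have h : Integrable fun s : ℝ => ((zetaReg n (ε * s) : ℝ) : ℂ) := (zeta_integrable n hn ε hε).ofReal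
  have h2 : Integrable fun s : ℝ => Complex.exp (((s * Real.log (x / y) : ℝ) : ℂ) * Complex.I) *
      ((zetaReg n (ε * s) : ℝ) : ℂ) := by
    refine h.bdd_mul (c := 1) ?_ (Eventually.of_forall fun s => ?_)
    · exact Continuous.aestronglyMeasurable (by fun_prop)
    · rw [Complex.norm_exp_ofReal_mul_I]
  refine (h2.const_mul ((((Real.sign x * Real.sign y) ^ l * (|x| / |y|) ^ (n - 1 - (b : ℕ)) / |y|) : ℝ) : ℂ)).congr
    (Eventually.of_forall fun s => ?_)
  simp only
  ring

theorem factor_eq (n : ℕ) (hn : 1 ≤ n) (ε : ℝ) (hε : 0 < ε) (b : Fin n) (x y : ℝ) (hx : x ≠ 0)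
    (hy : y ≠ 0) : ∑ l : Fin 2, ∫ s : ℝ, ((zetaReg n (ε * s) : ℝ) : ℂ) *
      (ent (Complex.I * (s : ℝ) + ((n - 1 - (b : ℕ) : ℕ) : ℂ)) (l : ℕ) x *
      ent (-(Complex.I * (s : ℝ)) + (((b : ℕ) : ℤ) - (n : ℤ) : ℤ)) (l : ℕ) y) =
     4 * (Real.pi : ℂ) * ((kt n ε x y * (x / y) ^ (n - 1 - (b : ℕ) + 1) : ℝ) : ℂ) := by
  have e : ∀ l : ℕ, ∫ s : ℝ, ((zetaReg n (ε * s) : ℝ) : ℂ) *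
      (ent (Complex.I * (s : ℝ) + ((n - 1 - (b : ℕ) : ℕ) : ℂ)) l x *
      ent (-(Complex.I * (s : ℝ)) + (((b : ℕ) : ℤ) - (n : ℤ) : ℤ)) l y) =
      ((((Real.sign x * Real.sign y) ^ l * (|x| / |y|) ^ (n - 1 - (b : ℕ)) / |y|) : ℝ) : ℂ) *
      ((2 * Real.pi * (kerK n (Real.log (x / y) / ε) / ε) : ℝ) : ℂ) := by
    intro l
    rw [← zeta_fourier n hn ε hε, ← integral_const_mul]
    refine integral_congr_ae (Eventually.of_forall fun s => ?_)
    simp only [ent_mul_ent n b x y hx hy]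
    ring
  simp_rw [e]
  rw [Fin.sum_univ_two]
  simp only [Fin.val_zero, Fin.val_one, pow_zero, pow_one]
  rw [← add_mul, ← Complex.ofReal_add, ← Complex.ofReal_mul,
    show 4 * (Real.pi : ℂ) = ((4 * Real.pi : ℝ) : ℂ) by push_cast; ring, ← Complex.ofReal_mul]
  congr 1
  unfold kt
  rcases lt_or_gt_of_ne hx with hx | hx <;> rcases lt_or_gt_of_ne hy with hy | hy
  · rw [if_pos (mul_pos_of_neg_of_neg hx hy), Real.sign_of_neg hx, Real.sign_of_neg hy, abs_of_neg hx,
      abs_of_neg hy, neg_div_neg_eq, pow_succ]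
    field_simp
    ring
  · rw [if_neg (by nlinarith), Real.sign_of_neg hx, Real.sign_of_pos hy]
    ring
  · rw [if_neg (by nlinarith), Real.sign_of_pos hx, Real.sign_of_neg hy]
    ring
  · rw [if_pos (mul_pos hx hy), Real.sign_of_pos hx, Real.sign_of_pos hy, abs_of_pos hx,
      abs_of_pos hy, pow_succ]
    field_simp
    ring

/-- one term of the double expansion -/
def termT (n : ℕ) (ε : ℝ) (x a : Fin n → ℝ) (σ τ : Equiv.Perm (Fin n)) : ℝ :=
  ∏ b : Fin n, (kt n ε (x (σ b)) (a (τ b)) * (x (σ b) / a (τ b)) ^ (n - 1 - (b : ℕ) + 1))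

/-- The double antisymmetrised kernel. -/
def PhiK (n : ℕ) (ε : ℝ) (x a : Fin n → ℝ) : ℝ :=
  ∑ σ : Equiv.Perm (Fin n), ∑ τ : Equiv.Perm (Fin n),
    ((Equiv.Perm.sign σ : ℤ) : ℝ) * ((Equiv.Perm.sign τ : ℤ) : ℝ) * termT n ε x a σ τ

theorem det_expand {n : ℕ} (M : Fin n → Fin n → ℂ) :
    (Matrix.of M).det = ∑ σ : Equiv.Perm (Fin n), ((Equiv.Perm.sign σ : ℤ) : ℂ) * ∏ b, M b (σ b) := by
  rw [← Matrix.det_transpose, Matrix.det_apply']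
  rfl

theorem sum_L_integral (n : ℕ) (hn : 1 ≤ n) (ε : ℝ) (hε : 0 < ε) (x a : Fin n → ℝ)
    (hx : ∀ c, x c ≠ 0) (ha : ∀ c, a c ≠ 0) :
    ∑ L : Fin n → Fin 2, ∫ s : Fin n → ℝ, det1 n (fun b => (L b : ℕ)) s x *
      ((∏ l : Fin n, ((zetaReg n (ε * s l) : ℝ) : ℂ)) * det2 n (fun b => (L b : ℕ)) s a) =
    (4 * (Real.pi : ℂ)) ^ n * ((PhiK n ε x a : ℝ) : ℂ) := by
  set f : Equiv.Perm (Fin n) → Equiv.Perm (Fin n) → Fin n → Fin 2 → ℝ → ℂ := fun σ τ b l s =>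
    ((zetaReg n (ε * s) : ℝ) : ℂ) *
      (ent (Complex.I * (s : ℝ) + ((n - 1 - (b : ℕ) : ℕ) : ℂ)) (l : ℕ) (x (σ b)) *
      ent (-(Complex.I * (s : ℝ)) + (((b : ℕ) : ℤ) - (n : ℤ) : ℤ)) (l : ℕ) (a (τ b))) with hf
  have hfi : ∀ σ τ b l, Integrable (f σ τ b l) := fun σ τ b l =>
    zent_integrable n hn ε hε b _ _ (hx _) (ha _) _
  have e1 : ∀ (L : Fin n → Fin 2) (s : Fin n → ℝ), det1 n (fun b => (L b : ℕ)) s x *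
      ((∏ l : Fin n, ((zetaReg n (ε * s l) : ℝ) : ℂ)) * det2 n (fun b => (L b : ℕ)) s a) =
      ∑ σ : Equiv.Perm (Fin n), ∑ τ : Equiv.Perm (Fin n),
        (((Equiv.Perm.sign σ : ℤ) : ℂ) * ((Equiv.Perm.sign τ : ℤ) : ℂ)) * ∏ b, f σ τ b (L b) (s b) := by
    intro L s
    unfold det1 det2
    rw [det_expand, det_expand, Finset.sum_mul]
    refine Finset.sum_congr rfl fun σ _ => ?_
    rw [Finset.mul_sum, Finset.mul_sum]
    refine Finset.sum_congr rfl fun τ _ => ?_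
    simp only [hf, Finset.prod_mul_distrib]
    ring
  have e2 : ∀ (L : Fin n → Fin 2), ∫ s : Fin n → ℝ, det1 n (fun b => (L b : ℕ)) s x *
      ((∏ l : Fin n, ((zetaReg n (ε * s l) : ℝ) : ℂ)) * det2 n (fun b => (L b : ℕ)) s a) =
      ∑ σ : Equiv.Perm (Fin n), ∑ τ : Equiv.Perm (Fin n),
        (((Equiv.Perm.sign σ : ℤ) : ℂ) * ((Equiv.Perm.sign τ : ℤ) : ℂ)) * ∏ b, ∫ s : ℝ, f σ τ b (L b) s := by
    intro L
    simp_rw [e1]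
    have hi : ∀ σ τ, Integrable fun s : Fin n → ℝ =>
        (((Equiv.Perm.sign σ : ℤ) : ℂ) * ((Equiv.Perm.sign τ : ℤ) : ℂ)) * ∏ b, f σ τ b (L b) (s b) := by
      intro σ τ
      exact (Integrable.fintype_prod (f := fun b => f σ τ b (L b)) fun b => hfi σ τ b (L b)).const_mul _
    rw [integral_finsetSum _ fun σ _ => integrable_finsetSum _ fun τ _ => hi σ τ]
    refine Finset.sum_congr rfl fun σ _ => ?_
    rw [integral_finsetSum _ fun τ _ => hi σ τ]
    refine Finset.sum_congr rfl fun τ _ => ?_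
    rw [integral_const_mul, integral_fintype_prod_volume_eq_prod (fun b => f σ τ b (L b))]
  simp_rw [e2]
  rw [Finset.sum_comm]
  unfold PhiK
  push_cast
  rw [Finset.mul_sum]
  refine Finset.sum_congr rfl fun σ _ => ?_
  rw [Finset.sum_comm, Finset.mul_sum]
  refine Finset.sum_congr rfl fun τ _ => ?_
  rw [← Finset.mul_sum]
  have e3 := Finset.prod_univ_sum (fun _ : Fin n => (Finset.univ : Finset (Fin 2)))
    (fun b l => ∫ s : ℝ, f σ τ b l s)
  rw [Fintype.piFinset_univ] at e3
  rw [← e3]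
  have e4 : ∀ b, ∑ l : Fin 2, ∫ s : ℝ, f σ τ b l s = 4 * (Real.pi : ℂ) *
      ((kt n ε (x (σ b)) (a (τ b)) * (x (σ b) / a (τ b)) ^ (n - 1 - (b : ℕ) + 1) : ℝ) : ℂ) := fun b =>
    factor_eq n hn ε hε b _ _ (hx _) (ha _)
  simp_rw [e4]
  rw [Finset.prod_mul_distrib, Finset.prod_const, Finset.card_univ, Fintype.card_fin, ← Complex.ofReal_prod]
  unfold termT
  ring

theorem VdmF_ofReal {n : ℕ} (a : Fin n → ℝ) : VdmCF (fun c => ((a c : ℝ) : ℂ)) = ((VdmF a : ℝ) : ℂ) := by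
  unfold VdmCF VdmF
  push_cast
  rfl

theorem PhiK_div_of_bad {n : ℕ} (ε : ℝ) (x a : Fin n → ℝ) (hx : badA x) : PhiK n ε x a / VdmF x = 0 := by
  rcases hx with ⟨c, hc⟩ | ⟨c, d, hne, hcd⟩
  · have : PhiK n ε x a = 0 := by
      refine Finset.sum_eq_zero fun σ _ => Finset.sum_eq_zero fun τ _ => ?_
      have : termT n ε x a σ τ = 0 := by
        refine Finset.prod_eq_zero (Finset.mem_univ (σ.symm c)) ?_
        simp [kt, hc]
      rw [this, mul_zero]
    rw [this, zero_div]
  · have : VdmF x = 0 := by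
      unfold VdmF
      rcases lt_or_gt_of_ne hne with h | h
      · refine Finset.prod_eq_zero (Finset.mem_univ d) (Finset.prod_eq_zero (Finset.mem_Iio.2 h) ?_)
        rw [hcd, sub_self]
      · refine Finset.prod_eq_zero (Finset.mem_univ c) (Finset.prod_eq_zero (Finset.mem_Iio.2 h) ?_)
        rw [hcd, sub_self]
    rw [this, div_zero]

theorem inv_formula (n : ℕ) (hn : 1 ≤ n) (p : (Fin n → ℝ) → ℝ) (hp : Integrable p)
    (ε : ℝ) (hε : 0 < ε) (a : Fin n → ℝ) (ha : ∀ c, a c ≠ 0) :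
    ((VdmF a : ℝ) : ℂ) /
              (((Nat.factorial n : ℂ)) ^ 2 * ∏ j ∈ Finset.range n, (Nat.factorial j : ℂ)) *
            ∑ L : Fin n → Fin 2,
              ((4 * (Real.pi : ℂ)) ^ n)⁻¹ * ∫ s' : Fin n → ℝ, invIntegrand n p a L ε s' =
    ((VdmF a / (Nat.factorial n) ^ 2 * ∫ x, p x * (PhiK n ε x a / VdmF x) : ℝ) : ℂ) := by
  have hP : (∏ j ∈ Finset.range n, (Nat.factorial j : ℂ)) ≠ 0 :=
    Finset.prod_ne_zero_iff.2 fun j _ => by exact_mod_cast (Nat.factorial_ne_zero j)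
  have hpi : (4 * (Real.pi : ℂ)) ^ n ≠ 0 :=
    pow_ne_zero _ (mul_ne_zero (by norm_num) (by exact_mod_cast Real.pi_ne_zero))
  have hnf : (Nat.factorial n : ℂ) ≠ 0 := by exact_mod_cast (Nat.factorial_ne_zero n)
  rw [← Finset.mul_sum]
  simp_rw [integral_invIntegrand n hn p hp ε hε]
  rw [← Finset.mul_sum, ← integral_finsetSum _ fun L _ => integral_invIntegrand_int n hn p hp ε hε L a]
  have e : ∀ x : Fin n → ℝ, ∑ L : Fin n → Fin 2, (p x : ℂ) * ∫ s : Fin n → ℝ, detD n (fun b => (L b : ℕ)) s x *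
        ((∏ l : Fin n, ((zetaReg n (ε * s l) : ℝ) : ℂ)) * det2 n (fun b => (L b : ℕ)) s a) =
      (4 * (Real.pi : ℂ)) ^ n * ((p x * (PhiK n ε x a / VdmF x) : ℝ) : ℂ) := by
    intro x
    by_cases hb : badA x
    · rw [PhiK_div_of_bad ε x a hb]
      simp [detD, hb]
    · rw [← Finset.mul_sum]
      simp only [detD, hb, if_false]
      have e5 : ∀ L : Fin n → Fin 2, ∫ s : Fin n → ℝ, det1 n (fun b => (L b : ℕ)) s x / VdmCF (fun c => ((x c : ℝ) : ℂ)) *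
        ((∏ l : Fin n, ((zetaReg n (ε * s l) : ℝ) : ℂ)) * det2 n (fun b => (L b : ℕ)) s a) =
        (VdmCF (fun c => ((x c : ℝ) : ℂ)))⁻¹ * ∫ s : Fin n → ℝ, det1 n (fun b => (L b : ℕ)) s x *
        ((∏ l : Fin n, ((zetaReg n (ε * s l) : ℝ) : ℂ)) * det2 n (fun b => (L b : ℕ)) s a) := by
        intro L
        rw [← integral_const_mul]
        refine integral_congr_ae (Eventually.of_forall fun s => ?_)
        simp only
        ring
      simp_rw [e5]
      rw [← Finset.mul_sum, sum_L_integral n hn ε hε x a (not_badA hb).2 ha, VdmF_ofReal]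
      push_cast
      ring
  simp_rw [e]
  rw [integral_const_mul, integral_complex_ofReal]
  push_cast
  field_simp

theorem approx_id {n : ℕ} (p : (Fin n → ℝ) → ℝ) (hp : Integrable p) (a : Fin n → ℝ)
    (hL : Tendsto (fun r : ℝ => ⨍ y in Metric.closedBall a r, ‖p y - p a‖) (nhdsWithin 0 (Set.Ioi 0)) (nhds 0))
    (G : (Fin n → ℝ) → ℝ) (hGm : Measurable G) (hGc : ContinuousAt G a)
    (W : ℝ → (Fin n → ℝ) → ℝ) (C R : ℝ) (hC : 0 ≤ C) (hR : 0 < R)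
    (hWm : ∀ ε, Measurable (W ε)) (hW0 : ∀ ε, 0 < ε → ∀ y, 0 ≤ W ε y)
    (hWb : ∀ ε, 0 < ε → ε < 1 → ∀ y, W ε y ≤ C * (ε ^ n)⁻¹)
    (hWs : ∀ ε, 0 < ε → ε < 1 → ∀ y, y ∉ Metric.closedBall a (R * ε) → W ε y = 0)
    (hW1 : ∀ ε, 0 < ε → ∫ y, W ε y = 1) :
    (∀ᶠ ε in nhdsWithin 0 (Set.Ioi 0), Integrable fun y => p y * (G y * W ε y)) ∧
    Tendsto (fun ε => ∫ y, p y * (G y * W ε y)) (nhdsWithin 0 (Set.Ioi 0)) (nhds (p a * G a)) := by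
  have hWi : ∀ ε, 0 < ε → Integrable (W ε) := by
    intro ε hε
    by_contra h
    have := integral_undef h
    rw [hW1 ε hε] at this
    exact one_ne_zero this
  have hpos : ∀ᶠ ε : ℝ in nhdsWithin 0 (Set.Ioi 0), 0 < ε ∧ ε < 1 := by
    filter_upwards [Ioo_mem_nhdsGT (zero_lt_one' ℝ)] with ε h using h
  have hsmall : Tendsto (fun ε : ℝ => R * ε) (nhdsWithin 0 (Set.Ioi 0)) (nhdsWithin 0 (Set.Ioi 0)) := by
    refine tendsto_nhdsWithin_iff.2 ⟨?_, ?_⟩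
    · have : Tendsto (fun ε : ℝ => R * ε) (nhds 0) (nhds (R * 0)) := (continuous_const.mul continuous_id).tendsto 0
      rw [mul_zero] at this
      exact this.mono_left nhdsWithin_le_nhds
    · filter_upwards [hpos] with ε h
      exact mul_pos hR h.1
  -- G close to G a
  have hGδ : ∀ δ > 0, ∀ᶠ ε in nhdsWithin 0 (Set.Ioi 0), ∀ y ∈ Metric.closedBall a (R * ε), |G y - G a| ≤ δ := by
    intro δ hδ
    obtain ⟨r, hr, h⟩ := Metric.continuousAt_iff.1 hGc δ hδ
    have h1 : ∀ᶠ ε in nhdsWithin 0 (Set.Ioi 0), R * ε < r :=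
      (hsmall.mono_right nhdsWithin_le_nhds).eventually (gt_mem_nhds hr)
    filter_upwards [h1] with ε h1 y hy
    have := h (lt_of_le_of_lt (Metric.mem_closedBall.1 hy) h1)
    rw [Real.dist_eq] at this
    exact this.le
  set M := |G a| + 1 with hM
  have hM0 : 0 < M := by positivity
  have hGM : ∀ᶠ ε in nhdsWithin 0 (Set.Ioi 0), ∀ y ∈ Metric.closedBall a (R * ε), |G y| ≤ M := by
    filter_upwards [hGδ 1 one_pos] with ε h y hy
    have h1 := h y hy
    have h2 := abs_sub_abs_le_abs_sub (G y) (G a)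
    rw [hM]; linarith
  have hintg : ∀ᶠ ε in nhdsWithin 0 (Set.Ioi 0), Integrable fun y => p y * (G y * W ε y) := by
    filter_upwards [hGM, hpos] with ε hG hε
    refine (hp.mul_const (M * (C * (ε ^ n)⁻¹))).mono ?_ (Eventually.of_forall fun y => ?_)
    · exact hp.1.mul (hGm.mul (hWm ε)).aestronglyMeasurable
    · have hε0 := hε.1
      by_cases hy : y ∈ Metric.closedBall a (R * ε)
      · have h1 := hG y hy
        have h2 := hWb ε hε.1 hε.2 y
        have h3 := hW0 ε hε.1 y
        rw [Real.norm_eq_abs, Real.norm_eq_abs, abs_mul, abs_mul, abs_mul, abs_of_nonneg h3,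
          abs_of_nonneg (show 0 ≤ M * (C * (ε ^ n)⁻¹) by positivity)]
        gcongr
      · rw [hWs ε hε.1 hε.2 y hy, mul_zero, mul_zero, norm_zero]
        exact norm_nonneg _
  refine ⟨hintg, ?_⟩
  rw [Metric.tendsto_nhds]
  intro η hη
  set K := M * C * (2 * R) ^ n with hK
  have hK0 : 0 ≤ K := by positivity
  set δ := η / (2 * (|p a| + 1)) with hδ
  have hδ0 : 0 < δ := by positivity
  have havg : ∀ᶠ ε in nhdsWithin 0 (Set.Ioi 0),
      (⨍ y in Metric.closedBall a (R * ε), ‖p y - p a‖) < η / (2 * (K + 1)) := by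
    have := hL.comp hsmall
    exact this.eventually (gt_mem_nhds (by positivity))
  filter_upwards [hintg, hpos, hGM, hGδ δ hδ0, havg] with ε hi hε hG1 hG2 hav
  obtain ⟨hε0, hε1⟩ := hε
  have hRε : 0 < R * ε := mul_pos hR hε0
  have hi2 : Integrable fun y => p a * G a * W ε y := (hWi ε hε0).const_mul _
  have e1 : (∫ y, p y * (G y * W ε y)) - p a * G a = ∫ y, (p y * (G y * W ε y) - p a * G a * W ε y) := by
    rw [integral_sub hi hi2, integral_const_mul, hW1 ε hε0, mul_one]
  have hballfin : volume (Metric.closedBall a (R * ε)) < ⊤ := measure_closedBall_lt_top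
  have hi3 : IntegrableOn (fun y => ‖p y - p a‖) (Metric.closedBall a (R * ε)) :=
    (hp.integrableOn.sub (integrableOn_const hballfin.ne)).norm
  have hi4 : Integrable ((Metric.closedBall a (R * ε)).indicator fun y => ‖p y - p a‖) :=
    hi3.integrable_indicator measurableSet_closedBall
  have hb : ‖∫ y, (p y * (G y * W ε y) - p a * G a * W ε y)‖ ≤
      ∫ y, (M * (C * (ε ^ n)⁻¹) * (Metric.closedBall a (R * ε)).indicator (fun y => ‖p y - p a‖) y
        + |p a| * δ * W ε y) := by
    refine norm_integral_le_of_norm_le ((hi4.const_mul _).add ((hWi ε hε0).const_mul _))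
      (Eventually.of_forall fun y => ?_)
    by_cases hy : y ∈ Metric.closedBall a (R * ε)
    · have h1 := hG1 y hy
      have h1' := hG2 y hy
      have h2 := hWb ε hε0 hε1 y
      have h3 := hW0 ε hε0 y
      rw [Set.indicator_of_mem hy]
      have : p y * (G y * W ε y) - p a * G a * W ε y =
        G y * W ε y * (p y - p a) + p a * (G y - G a) * W ε y := by ring
      rw [this]
      refine (norm_add_le _ _).trans ?_
      simp only [norm_mul, Real.norm_eq_abs, abs_of_nonneg h3]
      gcongr
    · rw [hWs ε hε0 hε1 y hy, Set.indicator_of_notMem hy]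
      simp
  rw [integral_add (hi4.const_mul _) ((hWi ε hε0).const_mul _), integral_const_mul, integral_const_mul,
    hW1 ε hε0, mul_one, integral_indicator measurableSet_closedBall] at hb
  have hvol : volume.real (Metric.closedBall a (R * ε)) = (2 * (R * ε)) ^ n := by
    rw [measureReal_def, Real.volume_pi_closedBall a hRε.le, Fintype.card_fin,
      ENNReal.toReal_ofReal (by positivity)]
  have hav2 : ∫ y in Metric.closedBall a (R * ε), ‖p y - p a‖ =
      (2 * (R * ε)) ^ n * ⨍ y in Metric.closedBall a (R * ε), ‖p y - p a‖ := by
    rw [setAverage_eq, hvol, smul_eq_mul, ← mul_assoc, mul_inv_cancel₀ (by positivity), one_mul]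
  rw [hav2] at hb
  set A := ⨍ y in Metric.closedBall a (R * ε), ‖p y - p a‖ with hA
  have e2 : M * (C * (ε ^ n)⁻¹) * ((2 * (R * ε)) ^ n * A) = K * A := by
    rw [hK, mul_pow, mul_pow, mul_pow]
    field_simp
  rw [e2] at hb
  rw [Real.dist_eq, e1, ← Real.norm_eq_abs]
  refine lt_of_le_of_lt hb ?_
  have t1 : K * A ≤ K * (η / (2 * (K + 1))) := by gcongr
  have t2 : K * (η / (2 * (K + 1))) < η / 2 := by
    rw [← mul_div_assoc, div_lt_div_iff₀ (by positivity) (by positivity)]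
    nlinarith
  have t3 : |p a| * δ ≤ η / 2 := by
    rw [hδ, ← mul_div_assoc, div_le_div_iff₀ (by positivity) (by positivity)]
    nlinarith [abs_nonneg (p a)]
  linarith

theorem kt_nonneg (n : ℕ) (ε : ℝ) (hε : 0 < ε) (x y : ℝ) : 0 ≤ kt n ε x y := by
  unfold kt
  split_ifs
  · have := kerK_nonneg n (Real.log (x / y) / ε)
    positivity
  · exact le_rfl

theorem kt_measurable (n : ℕ) (ε y : ℝ) : Measurable fun x => kt n ε x y := by
  unfold kt
  refine Measurable.ite (measurableSet_lt measurable_const (measurable_id.mul_const y)) ?_ measurable_const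
  refine Measurable.div (Measurable.div_const ?_ _) measurable_id.abs
  refine (kerK_continuous n).measurable.comp (Measurable.div_const ?_ _)
  exact Real.measurable_log.comp (measurable_id.div_const y)

theorem kt_integral (n : ℕ) (hn : 1 ≤ n) (ε : ℝ) (hε : 0 < ε) (y : ℝ) (hy : y ≠ 0) :
    ∫ x, kt n ε x y = 1 := by
  have himg : Set.image (fun u : ℝ => y * Real.exp (ε * u)) Set.univ = {x | 0 < x * y} := by
    ext x
    simp only [Set.image_univ, Set.mem_range]
    constructor
    · rintro ⟨u, rfl⟩
      show 0 < y * Real.exp (ε * u) * y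
      have : y * Real.exp (ε * u) * y = y ^ 2 * Real.exp (ε * u) := by ring
      rw [this]; positivity
    · intro (h : 0 < x * y)
      have hxy : 0 < x / y := by
        have : x / y = x * y / y ^ 2 := by field_simp
        rw [this]; positivity
      refine ⟨Real.log (x / y) / ε, ?_⟩
      rw [mul_div_cancel₀ _ hε.ne', Real.exp_log hxy]
      field_simp
  have hms : MeasurableSet {x : ℝ | 0 < x * y} :=
    measurableSet_lt measurable_const (measurable_id.mul_const y)
  have h1 : ∫ x, kt n ε x y = ∫ x in {x | 0 < x * y}, kerK n (Real.log (x / y) / ε) / ε / |x| := by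
    rw [← integral_indicator hms]
    refine integral_congr_ae (Eventually.of_forall fun x => ?_)
    simp only [kt, Set.indicator]
    rfl
  rw [h1, ← himg, integral_image_eq_integral_abs_deriv_smul (f' := fun u => y * (Real.exp (ε * u) * ε)) MeasurableSet.univ]
  · rw [setIntegral_univ, ← integral_kerK n hn]
    refine integral_congr_ae (Eventually.of_forall fun u => ?_)
    simp only
    have e : y * Real.exp (ε * u) / y = Real.exp (ε * u) := by field_simp
    have hE := Real.exp_pos (ε * u)
    have hy' := abs_pos.2 hy
    rw [e, Real.log_exp, mul_div_cancel_left₀ _ hε.ne', abs_mul, abs_mul, abs_mul, abs_of_pos hE, abs_of_pos hε,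
      smul_eq_mul]
    field_simp
  · intro u _
    have h := ((Real.hasDerivAt_exp (ε * u)).comp u ((hasDerivAt_id u).const_mul ε)).const_mul y
    rw [mul_one] at h
    exact h.hasDerivWithinAt
  · intro u _ v _ h
    have h2 : Real.exp (ε * u) = Real.exp (ε * v) := mul_left_cancel₀ hy h
    exact mul_left_cancel₀ hε.ne' (Real.exp_injective h2)

theorem kt_ne_zero (n : ℕ) (ε : ℝ) (hε : 0 < ε) (x y : ℝ) (h : kt n ε x y ≠ 0) :
    ∃ u, |u| ≤ ε ∧ x = y * Real.exp u := by
  unfold kt at h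
  split_ifs at h with hxy
  swap
  · exact absurd rfl h
  have hy : y ≠ 0 := by rintro rfl; simp at hxy
  have hxy' : 0 < x / y := by
    have : x / y = x * y / y ^ 2 := by field_simp
    rw [this]; positivity
  refine ⟨Real.log (x / y), ?_, ?_⟩
  · by_contra hlt
    push Not at hlt
    refine h ?_
    rw [kerK_eq_zero, zero_div, zero_div]
    rw [abs_div, abs_of_pos hε, lt_div_iff₀ hε, one_mul]
    exact hlt
  · rw [Real.exp_log hxy']; field_simp

theorem kt_support (n : ℕ) (ε : ℝ) (hε : 0 < ε) (hε1 : ε < 1) (x y : ℝ) (h : kt n ε x y ≠ 0) :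
    |x - y| ≤ 2 * |y| * ε := by
  obtain ⟨u, hu, rfl⟩ := kt_ne_zero n ε hε x y h
  have h1 := Real.abs_exp_sub_one_le (hu.trans hε1.le)
  have : y * Real.exp u - y = y * (Real.exp u - 1) := by ring
  rw [this, abs_mul]
  nlinarith [abs_nonneg y]

theorem kt_bound (n : ℕ) (ε : ℝ) (hε : 0 < ε) (hε1 : ε < 1) (x y : ℝ) (hy : y ≠ 0) :
    kt n ε x y ≤ (cosI (2*(n-1)+1) 0)⁻¹ * Real.exp 1 / |y| * ε⁻¹ := by
  have hc := kerK_le n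
  have hc0 : 0 ≤ (cosI (2*(n-1)+1) 0)⁻¹ := (kerK_nonneg n 0).trans (hc 0)
  have hy' := abs_pos.2 hy
  by_cases h : kt n ε x y = 0
  · rw [h]; positivity
  · obtain ⟨u, hu, rfl⟩ := kt_ne_zero n ε hε x y h
    unfold kt
    split_ifs
    · rw [abs_mul, abs_of_pos (Real.exp_pos u)]
      have h1 : Real.exp (-1) ≤ Real.exp u := Real.exp_le_exp.2 (by linarith [(abs_le.1 hu).1])
      calc _ ≤ (cosI (2*(n-1)+1) 0)⁻¹ / ε / (|y| * Real.exp (-1)) := by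
            gcongr
            exact hc _
        _ = _ := by
          rw [Real.exp_neg]
          field_simp
    · positivity

theorem ae_not_badA (n : ℕ) : ∀ᵐ a : Fin n → ℝ, ¬ badA a := by
  have h1 : ∀ c : Fin n, ∀ᵐ a : Fin n → ℝ, a c ≠ 0 := by
    intro c
    have := Measure.addHaar_submodule (volume : Measure (Fin n → ℝ)) (LinearMap.ker (LinearMap.proj c : (Fin n → ℝ) →ₗ[ℝ] ℝ)) (by
      intro h
      have : (fun _ => 1 : Fin n → ℝ) ∈ LinearMap.ker (LinearMap.proj c : (Fin n → ℝ) →ₗ[ℝ] ℝ) := by rw [h]; trivial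
      simp at this)
    rw [ae_iff]
    refine measure_mono_null ?_ this
    intro a ha
    simpa using ha
  have h2 : ∀ c d : Fin n, c ≠ d → ∀ᵐ a : Fin n → ℝ, a c ≠ a d := by
    intro c d hcd
    have := Measure.addHaar_submodule (volume : Measure (Fin n → ℝ))
      (LinearMap.ker ((LinearMap.proj c : (Fin n → ℝ) →ₗ[ℝ] ℝ) - (LinearMap.proj d : (Fin n → ℝ) →ₗ[ℝ] ℝ))) (by
      intro h
      have : (Pi.single c 1 : Fin n → ℝ) ∈ LinearMap.ker ((LinearMap.proj c : (Fin n → ℝ) →ₗ[ℝ] ℝ) - (LinearMap.proj d : (Fin n → ℝ) →ₗ[ℝ] ℝ)) := by rw [h]; trivial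
      simp [hcd.symm] at this)
    rw [ae_iff]
    refine measure_mono_null ?_ this
    intro a ha
    have ha' : a c = a d := by simpa using ha
    show a c - a d = 0
    rw [ha', sub_self]
  have h1' := ae_all_iff.2 h1
  have h2' : ∀ᵐ a : Fin n → ℝ, ∀ c d, c ≠ d → a c ≠ a d := by
    rw [ae_all_iff]; intro c
    rw [ae_all_iff]; intro d
    by_cases hcd : c = d
    · exact Eventually.of_forall fun a h => absurd hcd h
    · filter_upwards [h2 c d hcd] with a ha _ using ha
  filter_upwards [h1', h2'] with a ha hb
  rintro (⟨c, hc⟩ | ⟨c, d, hcd, he⟩)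
  · exact ha c hc
  · exact hb c d hcd he

/-- Product approximate identity. -/
def Wk (n : ℕ) (a : Fin n → ℝ) (ε : ℝ) (y : Fin n → ℝ) : ℝ := ∏ c, kt n ε (y c) (a c)

/-- The smooth factor. -/
def Gk (n : ℕ) (a : Fin n → ℝ) (τ : Equiv.Perm (Fin n)) (y : Fin n → ℝ) : ℝ :=
  (∏ b : Fin n, (y (τ b) / a (τ b)) ^ (n - 1 - (b : ℕ) + 1)) / VdmF y

theorem VdmF_continuous {n : ℕ} : Continuous (VdmF (n := n)) := by
  unfold VdmF; fun_prop

theorem VdmF_ne_zero {n : ℕ} {a : Fin n → ℝ} (h : ¬ badA a) : VdmF a ≠ 0 := by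
  have := VdmCF_ne_zero (fun c => ((a c : ℝ) : ℂ)) (fun c d hcd => (not_badA h).1 (Complex.ofReal_injective hcd))
  rw [VdmF_ofReal] at this
  exact_mod_cast this

theorem key_limit (n : ℕ) (hn : 1 ≤ n) (p : (Fin n → ℝ) → ℝ) (hp : Integrable p) (a : Fin n → ℝ)
    (ha : ¬ badA a)
    (hL : Tendsto (fun r : ℝ => ⨍ y in Metric.closedBall a r, ‖p y - p a‖) (nhdsWithin 0 (Set.Ioi 0)) (nhds 0))
    (τ : Equiv.Perm (Fin n)) :
    (∀ᶠ ε in nhdsWithin 0 (Set.Ioi 0), Integrable fun y => p y * (Gk n a τ y * Wk n a ε y)) ∧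
    Tendsto (fun ε => ∫ y, p y * (Gk n a τ y * Wk n a ε y)) (nhdsWithin 0 (Set.Ioi 0)) (nhds (p a * (VdmF a)⁻¹)) := by
  obtain ⟨hinj, ha0⟩ := not_badA ha
  have hV := VdmF_ne_zero ha
  have hGa : Gk n a τ a = (VdmF a)⁻¹ := by
    unfold Gk
    rw [Finset.prod_eq_one, one_div]
    intro b _
    rw [div_self (ha0 _), one_pow]
  rw [← hGa]
  have hcK : 0 ≤ (cosI (2*(n-1)+1) 0)⁻¹ := (kerK_nonneg n 0).trans (kerK_le n 0)
  have hnum : Continuous fun y : Fin n → ℝ => ∏ b : Fin n, (y (τ b) / a (τ b)) ^ (n - 1 - (b : ℕ) + 1) := by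
    fun_prop
  refine approx_id p hp a hL (Gk n a τ) ?_ ?_ (Wk n a)
    (∏ c, ((cosI (2*(n-1)+1) 0)⁻¹ * Real.exp 1 / |a c|)) (1 + ∑ c, 2 * |a c|) ?_ ?_ ?_ ?_ ?_ ?_ ?_
  · exact hnum.measurable.div VdmF_continuous.measurable
  · exact hnum.continuousAt.div VdmF_continuous.continuousAt hV
  · exact Finset.prod_nonneg fun c _ => by positivity
  · positivity
  · intro ε
    exact Finset.measurable_prod _ fun c _ => (kt_measurable n ε (a c)).comp (measurable_pi_apply c)
  · intro ε hε y
    exact Finset.prod_nonneg fun c _ => kt_nonneg n ε hε _ _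
  · intro ε hε hε1 y
    calc Wk n a ε y ≤ ∏ c, ((cosI (2*(n-1)+1) 0)⁻¹ * Real.exp 1 / |a c| * ε⁻¹) :=
          Finset.prod_le_prod (fun c _ => kt_nonneg n ε hε _ _) fun c _ => kt_bound n ε hε hε1 _ _ (ha0 c)
      _ = _ := by
        rw [Finset.prod_mul_distrib, Finset.prod_const, Finset.card_univ, Fintype.card_fin, inv_pow]
  · intro ε hε hε1 y hy
    by_contra hne
    apply hy
    rw [Metric.mem_closedBall, dist_pi_le_iff (by positivity)]
    intro c
    rw [Real.dist_eq]
    have h1 := kt_support n ε hε hε1 (y c) (a c) (Finset.prod_ne_zero_iff.1 hne c (Finset.mem_univ c))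
    refine h1.trans (mul_le_mul_of_nonneg_right ?_ hε.le)
    have := Finset.single_le_sum (f := fun c => 2 * |a c|) (fun c _ => by positivity) (Finset.mem_univ c)
    linarith
  · intro ε hε
    unfold Wk
    rw [integral_fintype_prod_volume_eq_prod (fun c x => kt n ε x (a c))]
    exact Finset.prod_eq_one fun c _ => kt_integral n hn ε hε _ (ha0 c)

theorem integral_perm {n : ℕ} (ρ : Equiv.Perm (Fin n)) :
    MeasurePreserving (fun x : Fin n → ℝ => x ∘ ρ) volume volume := by
  have := volume_measurePreserving_piCongrLeft (fun _ : Fin n => ℝ) ρ.symm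
  convert this using 1
  funext x
  ext i
  have h := MeasurableEquiv.piCongrLeft_apply_apply (β := fun _ : Fin n => ℝ) (e := ρ.symm) x (ρ i)
  simpa using h.symm

theorem VdmF_perm {n : ℕ} (x : Fin n → ℝ) (ρ : Equiv.Perm (Fin n)) :
    VdmF (x ∘ ρ) = ((Equiv.Perm.sign ρ : ℤ) : ℝ) * VdmF x := by
  have := VdmCF_perm (fun c => ((x c : ℝ) : ℂ)) ρ
  have e : ((fun c => ((x c : ℝ) : ℂ)) ∘ ρ) = fun c => (((x ∘ ρ) c : ℝ) : ℂ) := rfl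
  rw [e, VdmF_ofReal, VdmF_ofReal] at this
  exact_mod_cast this

theorem term_rearrange (n : ℕ) (p : (Fin n → ℝ) → ℝ)
    (hsymm : ∀ (σ : Equiv.Perm (Fin n)) (a : Fin n → ℝ), p (a ∘ σ) = p a) (ε : ℝ) (x a : Fin n → ℝ)
    (σ τ : Equiv.Perm (Fin n)) :
    p x * (((Equiv.Perm.sign σ : ℤ) : ℝ) * ((Equiv.Perm.sign τ : ℤ) : ℝ) * termT n ε x a σ τ / VdmF x) =
    p (x ∘ (σ * τ⁻¹ : Equiv.Perm (Fin n))) * (Gk n a τ (x ∘ (σ * τ⁻¹ : Equiv.Perm (Fin n)))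
      * Wk n a ε (x ∘ (σ * τ⁻¹ : Equiv.Perm (Fin n)))) := by
  rw [hsymm]
  unfold Gk Wk termT
  rw [VdmF_perm]
  have e1 : ∀ b, (x ∘ (σ * τ⁻¹ : Equiv.Perm (Fin n))) (τ b) = x (σ b) := by intro b; simp
  have e2 : ∏ c, kt n ε ((x ∘ (σ * τ⁻¹ : Equiv.Perm (Fin n))) c) (a c) = ∏ b, kt n ε (x (σ b)) (a (τ b)) := by
    rw [← Equiv.prod_comp τ]
    simp only [e1]
  rw [e2]
  simp only [e1]
  rw [Finset.prod_mul_distrib]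
  have hs : ((Equiv.Perm.sign (σ * τ⁻¹) : ℤ) : ℝ) = ((Equiv.Perm.sign σ : ℤ) : ℝ) * ((Equiv.Perm.sign τ : ℤ) : ℝ) := by
    simp
  rw [hs]
  rcases Int.units_eq_one_or (Equiv.Perm.sign σ) with h | h <;>
    rcases Int.units_eq_one_or (Equiv.Perm.sign τ) with h' | h' <;> simp only [h, h', Units.val_one, Units.val_neg, Int.cast_one, Int.cast_neg] <;> ring

theorem limit_formula (n : ℕ) (hn : 1 ≤ n) (p : (Fin n → ℝ) → ℝ) (hp : Integrable p)
    (hsymm : ∀ (σ : Equiv.Perm (Fin n)) (a : Fin n → ℝ), p (a ∘ σ) = p a) (a : Fin n → ℝ)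
    (ha : ¬ badA a)
    (hL : Tendsto (fun r : ℝ => ⨍ y in Metric.closedBall a r, ‖p y - p a‖) (nhdsWithin 0 (Set.Ioi 0)) (nhds 0)) :
    Tendsto (fun ε => VdmF a / (Nat.factorial n) ^ 2 * ∫ x, p x * (PhiK n ε x a / VdmF x))
      (nhdsWithin 0 (Set.Ioi 0)) (nhds (p a)) := by
  have hV := VdmF_ne_zero ha
  have hlim := fun τ => (key_limit n hn p hp a ha hL τ).2
  have hintg : ∀ᶠ ε in nhdsWithin 0 (Set.Ioi 0), ∀ τ, Integrable fun y => p y * (Gk n a τ y * Wk n a ε y) :=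
    eventually_all.2 fun τ => (key_limit n hn p hp a ha hL τ).1
  have hsum : Tendsto (fun ε => VdmF a / (Nat.factorial n) ^ 2 * ∑ σ : Equiv.Perm (Fin n), ∑ τ : Equiv.Perm (Fin n),
      ∫ y, p y * (Gk n a τ y * Wk n a ε y)) (nhdsWithin 0 (Set.Ioi 0))
      (nhds (VdmF a / (Nat.factorial n) ^ 2 * ∑ σ : Equiv.Perm (Fin n), ∑ τ : Equiv.Perm (Fin n), p a * (VdmF a)⁻¹)) :=
    (tendsto_finsetSum _ fun σ _ => tendsto_finsetSum _ fun τ _ => hlim τ).const_mul _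
  have hval : VdmF a / (Nat.factorial n) ^ 2 * ∑ σ : Equiv.Perm (Fin n), ∑ τ : Equiv.Perm (Fin n), p a * (VdmF a)⁻¹ = p a := by
    have hf : (Nat.factorial n : ℝ) ≠ 0 := by exact_mod_cast (Nat.factorial_ne_zero n)
    simp only [Finset.sum_const, Finset.card_univ, Fintype.card_perm, Fintype.card_fin, nsmul_eq_mul]
    field_simp
  rw [hval] at hsum
  refine hsum.congr' ?_
  filter_upwards [hintg] with ε hi
  congr 1
  have hcomp : ∀ σ τ : Equiv.Perm (Fin n), Integrable fun x : Fin n → ℝ =>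
      p x * (((Equiv.Perm.sign σ : ℤ) : ℝ) * ((Equiv.Perm.sign τ : ℤ) : ℝ) * termT n ε x a σ τ / VdmF x) := by
    intro σ τ
    simp_rw [term_rearrange n p hsymm]
    exact (integral_perm (σ * τ⁻¹)).integrable_comp_of_integrable (hi τ)
  have hcompI : ∀ σ τ : Equiv.Perm (Fin n), ∫ x : Fin n → ℝ,
      p x * (((Equiv.Perm.sign σ : ℤ) : ℝ) * ((Equiv.Perm.sign τ : ℤ) : ℝ) * termT n ε x a σ τ / VdmF x) =
      ∫ y, p y * (Gk n a τ y * Wk n a ε y) := by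
    intro σ τ
    simp_rw [term_rearrange n p hsymm]
    have hmp := integral_perm (σ * τ⁻¹)
    have hm := integral_map hmp.measurable.aemeasurable (f := fun y => p y * (Gk n a τ y * Wk n a ε y))
      (by rw [hmp.map_eq]; exact (hi τ).1)
    rw [hmp.map_eq] at hm
    exact hm.symm
  have e : ∀ x, p x * (PhiK n ε x a / VdmF x) = ∑ σ : Equiv.Perm (Fin n), ∑ τ : Equiv.Perm (Fin n),
     p x * (((Equiv.Perm.sign σ : ℤ) : ℝ) * ((Equiv.Perm.sign τ : ℤ) : ℝ) * termT n ε x a σ τ / VdmF x) := by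
    intro x
    unfold PhiK
    simp_rw [← Finset.mul_sum, ← Finset.sum_div]
  simp_rw [e]
  symm
  rw [integral_finsetSum _ fun σ _ => integrable_finsetSum _ fun τ _ => hcomp σ τ]
  refine Finset.sum_congr rfl fun σ _ => ?_
  rw [integral_finsetSum _ fun τ _ => hcomp σ τ]
  exact Finset.sum_congr rfl fun τ _ => hcompI σ τ

theorem ae_lebesgue (n : ℕ) (p : (Fin n → ℝ) → ℝ) (hp : Integrable p) : ∀ᵐ a : Fin n → ℝ,
    Tendsto (fun r : ℝ => ⨍ y in Metric.closedBall a r, ‖p y - p a‖) (nhdsWithin 0 (Set.Ioi 0)) (nhds 0) := by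
  filter_upwards [IsUnifLocDoublingMeasure.ae_tendsto_average_norm_sub (μ := volume) hp.locallyIntegrable 1] with a ha
  refine ha (fun _ => a) (fun r => r) tendsto_id ?_
  filter_upwards [self_mem_nhdsWithin] with r hr
  have : (0:ℝ) < r := hr
  exact Metric.mem_closedBall_self (by linarith)

/-- Inversion formula for the spherical transform on `ℝ^n`: the regularized
inverse transform of `Sp` recovers `p` almost everywhere. -/
theorem statement7 (n : ℕ) (hn : 1 ≤ n) (p : (Fin n → ℝ) → ℝ)
    (hp : Integrable p)
    (hsymm : ∀ (σ : Equiv.Perm (Fin n)) (a : Fin n → ℝ), p (a ∘ σ) = p a) :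
    (∀ ε : ℝ, 0 < ε → ∀ L : Fin n → Fin 2, ∀ a : Fin n → ℝ,
      Integrable (invIntegrand n p a L ε)) ∧
    ∀ᵐ a : Fin n → ℝ,
      Tendsto
        (fun ε : ℝ =>
          ((VdmF a : ℝ) : ℂ) /
              (((Nat.factorial n : ℂ)) ^ 2 * ∏ j ∈ Finset.range n, (Nat.factorial j : ℂ)) *
            ∑ L : Fin n → Fin 2,
              ((4 * (Real.pi : ℂ)) ^ n)⁻¹ * ∫ s' : Fin n → ℝ, invIntegrand n p a L ε s')
        (nhdsWithin 0 (Set.Ioi 0)) (nhds ((p a : ℝ) : ℂ)) := by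
  refine ⟨fun ε hε L a => invIntegrand_integrable n hn p hp ε hε L a, ?_⟩
  filter_upwards [ae_not_badA n, ae_lebesgue n p hp] with a ha hL
  have h := (Complex.continuous_ofReal.tendsto (p a)).comp (limit_formula n hn p hp hsymm a ha hL)
  refine h.congr' ?_
  filter_upwards [self_mem_nhdsWithin] with ε hε
  exact (inv_formula n hn p hp ε hε a (not_badA ha).2).symm

end RMT
end
end

section
/- Let n ≥ 1, s ∈ ℂ^n, L ∈ {0,1}^n, and let w_1,…,w_n: ℝ → ℝ be measurable functions with ∫_ℝ |x|^{Re s_c} |w_b(x)| dx < ∞ for all b, c ∈ {1,…,n}. Then (1/n!) ∫_{ℝ^n} det[ w_b(a_c) ]_{b,c=1,…,n} · det[ sign(a_c)^{L_b} |a_c|^{s_b} ]_{b,c=1,…,n} da = det[ Mw_b(s_c + 1, L_c) ]_{b,c=1,…,n}. (This computes the spherical transform of a polynomial ensemble on the Hermitian matrices associated with the weights w_1,…,w_n.) -/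
open MeasureTheory Finset Filter Set
open scoped Classical

noncomputable section

namespace RMT

/-- The signed Mellin transform `Mw(s,L) = ∫_ℝ sign(x)^L |x|^{s-1} w(x) dx`. -/
def mellinSigned (w : ℝ → ℝ) (s : ℂ) (L : ℕ) : ℂ :=
  ∫ x : ℝ, ((Real.sign x : ℝ) : ℂ) ^ L * ((|x| : ℝ) : ℂ) ^ (s - 1) * (w x : ℂ)

theorem andreief (n : ℕ) (f g : Fin n → ℝ → ℂ)
    (h : ∀ b c, Integrable (fun x => f b x * g c x)) :
    ∫ a : Fin n → ℝ, Matrix.det (Matrix.of fun b c : Fin n => f b (a c)) *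
        Matrix.det (Matrix.of fun b c : Fin n => g b (a c)) =
      (Nat.factorial n : ℂ) * Matrix.det (Matrix.of fun b c : Fin n => ∫ x, f b x * g c x) := by
  have hI : ∀ σ τ : Equiv.Perm (Fin n),
      Integrable (fun a : Fin n → ℝ => ∏ c, (f (σ c) (a c) * g (τ c) (a c))) := fun σ τ =>
    Integrable.fintype_prod (f := fun c x => f (σ c) x * g (τ c) x) (fun c => h _ _)
  have h1 : ∀ a : Fin n → ℝ, Matrix.det (Matrix.of fun b c : Fin n => f b (a c)) *
        Matrix.det (Matrix.of fun b c : Fin n => g b (a c)) =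
      ∑ τ : Equiv.Perm (Fin n), ∑ σ : Equiv.Perm (Fin n),
        (((Equiv.Perm.sign τ : ℤ) : ℂ) * ((Equiv.Perm.sign σ : ℤ) : ℂ)) *
          ∏ c, (f (σ c) (a c) * g (τ c) (a c)) := by
    intro a
    rw [Matrix.det_apply', Matrix.det_apply', Finset.sum_mul_sum, Finset.sum_comm]
    refine Finset.sum_congr rfl fun τ _ => Finset.sum_congr rfl fun σ _ => ?_
    simp only [Matrix.of_apply, Finset.prod_mul_distrib]
    ring
  simp_rw [h1]
  rw [integral_finsetSum _ (fun τ _ => integrable_finsetSum _ fun σ _ => (hI σ τ).const_mul _)]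
  have h2 : ∀ τ : Equiv.Perm (Fin n),
      ∫ a : Fin n → ℝ, ∑ σ : Equiv.Perm (Fin n),
        (((Equiv.Perm.sign τ : ℤ) : ℂ) * ((Equiv.Perm.sign σ : ℤ) : ℂ)) *
          ∏ c, (f (σ c) (a c) * g (τ c) (a c)) =
      Matrix.det (Matrix.of fun b c : Fin n => ∫ x, f b x * g c x) := by
    intro τ
    rw [integral_finsetSum _ (fun σ _ => (hI σ τ).const_mul _)]
    have h3 := Matrix.det_permute' τ (Matrix.of fun b c : Fin n => ∫ x, f b x * g c x)
    have h4 : ((Equiv.Perm.sign τ : ℤ) : ℂ) * ((Equiv.Perm.sign τ : ℤ) : ℂ) = 1 := by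
      rcases Int.units_eq_one_or (Equiv.Perm.sign τ) with h | h <;> simp [h]
    rw [← one_mul (Matrix.det _), ← h4, mul_assoc, ← h3, Matrix.det_apply', Finset.mul_sum]
    refine Finset.sum_congr rfl fun σ _ => ?_
    rw [integral_const_mul,
      integral_fintype_prod_volume_eq_prod (fun c x => f (σ c) x * g (τ c) x), mul_assoc]
    rfl
  rw [Finset.sum_congr rfl fun τ _ => h2 τ]
  simp [Fintype.card_perm]

theorem norm_sign_le (x : ℝ) : ‖((Real.sign x : ℝ) : ℂ)‖ ≤ 1 := by
  rcases Real.sign_apply_eq x with h | h | h <;> simp [h]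

/-- Andréief-type identity: the spherical transform of a polynomial
ensemble on the Hermitian matrices is a determinant of signed Mellin transforms. -/
theorem statement9 (n : ℕ) (hn : 1 ≤ n) (s : Fin n → ℂ)
    (L : Fin n → ℕ) (hL : ∀ b, L b = 0 ∨ L b = 1)
    (w : Fin n → ℝ → ℝ) (hwmeas : ∀ b, Measurable (w b))
    (hwint : ∀ b c, Integrable (fun x : ℝ => |x| ^ (s c).re * |w b x|)) :
    (1 / (Nat.factorial n : ℂ)) *
        ∫ a : Fin n → ℝ,
          (if ∃ c, a c = 0 then 0 else
            Matrix.det (Matrix.of fun b c : Fin n => (w b (a c) : ℂ)) *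
              Matrix.det (Matrix.of fun b c : Fin n =>
                ((Real.sign (a c) : ℝ) : ℂ) ^ (L b) * ((|a c| : ℝ) : ℂ) ^ (s b))) =
      Matrix.det (Matrix.of fun b c : Fin n => mellinSigned (w b) (s c + 1) (L c)) := by
  let g : Fin n → ℝ → ℂ := fun b x => if x = 0 then 0 else
    ((Real.sign x : ℝ) : ℂ) ^ (L b) * ((|x| : ℝ) : ℂ) ^ (s b)
  have hg : ∀ b, Measurable (g b) := fun b => by
    have hs := measurable_sign'
    refine Measurable.ite (measurableSet_singleton 0) measurable_const ?_
    fun_prop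
  have hint : ∀ b c, Integrable (fun x => (w b x : ℂ) * g c x) := by
    intro b c
    refine (hwint b c).mono' ?_ (Eventually.of_forall fun x => ?_)
    · have h1 := hg c
      have h2 := hwmeas b
      exact Measurable.aestronglyMeasurable (by fun_prop)
    · by_cases hx : x = 0
      · simp only [g, hx, if_true, mul_zero, norm_zero]
        positivity
      · simp only [g, hx, if_false, norm_mul, norm_pow]
        rw [Complex.norm_cpow_eq_rpow_re_of_pos (abs_pos.mpr hx), Complex.norm_real,
          Real.norm_eq_abs, mul_comm]
        gcongr
        exact mul_le_of_le_one_left (by positivity)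
          (pow_le_one₀ (norm_nonneg _) (norm_sign_le x))
  have key := andreief n (fun b x => (w b x : ℂ)) g hint
  have hL1 : ∀ a : Fin n → ℝ, (if ∃ c, a c = 0 then 0 else
            Matrix.det (Matrix.of fun b c : Fin n => (w b (a c) : ℂ)) *
              Matrix.det (Matrix.of fun b c : Fin n =>
                ((Real.sign (a c) : ℝ) : ℂ) ^ (L b) * ((|a c| : ℝ) : ℂ) ^ (s b))) =
      Matrix.det (Matrix.of fun b c : Fin n => (w b (a c) : ℂ)) *
        Matrix.det (Matrix.of fun b c : Fin n => g b (a c)) := by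
    intro a
    split_ifs with h
    · obtain ⟨c, hc⟩ := h
      rw [Matrix.det_eq_zero_of_column_eq_zero (A := Matrix.of fun b c : Fin n => g b (a c)) c
        (fun i => by simp [g, hc]), mul_zero]
    · push Not at h
      simp [g, h]
  have hM : ∀ b c, mellinSigned (w b) (s c + 1) (L c) = ∫ x, (w b x : ℂ) * g c x := by
    intro b c
    unfold mellinSigned
    refine integral_congr_ae ?_
    filter_upwards [Measure.ae_ne volume (0 : ℝ)] with x hx
    simp only [g, hx, if_false, add_sub_cancel_right]
    ring
  simp_rw [hL1, hM]
  rw [key, ← mul_assoc, one_div,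
    inv_mul_cancel₀ (Nat.cast_ne_zero.mpr (Nat.factorial_ne_zero n)), one_mul]

end RMT
end
end
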